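/- arXiv:1309.0938 — 5 statements merged into one kernel-verified Lean document; each statement's English description precedes it below -/
import Mathlib

section
/- Let (r_n)_{n≥1} be a strictly increasing sequence of positive real numbers with r_n → ∞ as n → ∞. Then the linear span of the constant function 1 together with the functions e_{r_n} is dense in C([0,1],ℝ) (continuous real-valued functions on [0,1] with the supremum norm) if and only if ∑_{n=1}^∞ 1/r_n = ∞. -/
open Filter Topology

/-- For `r > 0`, the continuous function `t ↦ t ^ r` (real power) on `[0,1]`;
note that `(0:ℝ) ^ r = 0` for `r > 0`, matching `e_r(0) = 0`. -/
noncomputable def ePow (r : ℝ) : C(Set.Icc (0:ℝ) 1, ℝ) :=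
  if hr : 0 < r then
    ⟨fun t => (t : ℝ) ^ r, by
      refine continuous_iff_continuousAt.mpr fun x => ?_
      exact (Real.continuousAt_rpow_const _ _ (Or.inr hr.le)).comp continuous_subtype_val.continuousAt⟩
  else 1

lemma ePow_apply {p : ℝ} (hp : 0 ≤ p) (t : Set.Icc (0 : ℝ) 1) : ePow p t = (t : ℝ) ^ p := by
  rcases hp.eq_or_lt with rfl | hp
  · simp [ePow]
  · simp [ePow, hp]

lemma ePow_zero : ePow 0 = 1 := by
  simp [ePow]

/-- The extension to `ℝ` of a function on `[0,1]`, constant on both sides of the interval. -/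
noncomputable def extendIcc (f : C(Set.Icc (0 : ℝ) 1, ℝ)) (x : ℝ) : ℝ :=
  f (Set.projIcc 0 1 zero_le_one x)

lemma extendIcc_coe (f : C(Set.Icc (0 : ℝ) 1, ℝ)) (t : Set.Icc (0 : ℝ) 1) :
    extendIcc f t = f t := by
  simp [extendIcc]

lemma extendIcc_ePow {p x : ℝ} (hp : 0 ≤ p) (hx : x ∈ Set.Icc (0 : ℝ) 1) :
    extendIcc (ePow p) x = x ^ p := by
  rw [extendIcc, ePow_apply hp, Set.projIcc_of_mem _ hx]

lemma hasDerivAt_extendIcc_ePow {p x : ℝ} (hp : 0 ≤ p) (hx : x ∈ Set.Ioo (0 : ℝ) 1) :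
    HasDerivAt (extendIcc (ePow p)) (p * extendIcc (ePow p) x / x) x := by
  have h := Real.hasDerivAt_rpow_const (x := x) (p := p) (Or.inl hx.1.ne')
  rw [Real.rpow_sub_one hx.1.ne', ← mul_div_assoc,
    ← extendIcc_ePow hp (Set.Ioo_subset_Icc_self hx)] at h
  refine h.congr_of_eventuallyEq ?_
  filter_upwards [Ioo_mem_nhds hx.1 hx.2] with y hy
  exact extendIcc_ePow hp (Set.Ioo_subset_Icc_self hy)

/-- `g` solves the boundary value problem `g - x g' / l = f` on `(0,1)`, `g 0 = g 1 = 0`. -/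
structure IsEulerSolution (l : ℝ) (f g : C(Set.Icc (0 : ℝ) 1, ℝ)) : Prop where
  map_zero : g 0 = 0
  map_one : g 1 = 0
  hasDerivAt : ∀ x ∈ Set.Ioo (0 : ℝ) 1,
    HasDerivAt (extendIcc g) (l * (extendIcc g x - extendIcc f x) / x) x

namespace IsEulerSolution

variable {l : ℝ} {f g f₁ f₂ g₁ g₂ : C(Set.Icc (0 : ℝ) 1, ℝ)}

lemma zero : IsEulerSolution l 0 0 :=
  ⟨rfl, rfl, fun x _ =>
    (hasDerivAt_const x (0 : ℝ)).congr_deriv (by simp [extendIcc])⟩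

lemma add (h₁ : IsEulerSolution l f₁ g₁) (h₂ : IsEulerSolution l f₂ g₂) :
    IsEulerSolution l (f₁ + f₂) (g₁ + g₂) where
  map_zero := by simp [h₁.map_zero, h₂.map_zero]
  map_one := by simp [h₁.map_one, h₂.map_one]
  hasDerivAt x hx := by
    refine ((h₁.hasDerivAt x hx).add (h₂.hasDerivAt x hx)).congr_deriv ?_
    simp only [extendIcc, ContinuousMap.add_apply]
    ring

lemma smul (c : ℝ) (h : IsEulerSolution l f g) : IsEulerSolution l (c • f) (c • g) where
  map_zero := by simp [h.map_zero]
  map_one := by simp [h.map_one]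
  hasDerivAt x hx := by
    refine ((h.hasDerivAt x hx).const_mul c).congr_deriv ?_
    simp only [extendIcc, ContinuousMap.smul_apply, smul_eq_mul]
    ring

lemma of_ePow {p : ℝ} (hp : 0 < p) (hl : 0 < l) (hpl : p ≠ l) :
    IsEulerSolution l (ePow p) ((l / (p - l)) • (ePow l - ePow p)) where
  map_zero := by simp [ePow_apply, hp.le, hl.le, hp.ne', hl.ne']
  map_one := by simp [ePow_apply, hp.le, hl.le]
  hasDerivAt x hx := by
    refine (((hasDerivAt_extendIcc_ePow hl.le hx).sub
      (hasDerivAt_extendIcc_ePow hp.le hx)).const_mul (l / (p - l))).congr_deriv ?_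
    have := sub_ne_zero.mpr hpl
    have := hx.1.ne'
    simp only [extendIcc, ContinuousMap.smul_apply, ContinuousMap.sub_apply, smul_eq_mul]
    field_simp
    ring

/-- The maximum principle for the boundary value problem. -/
lemma norm_le (h : IsEulerSolution l f g) (hl : l ≠ 0) : ‖g‖ ≤ ‖f‖ := by
  obtain ⟨t, -, ht⟩ := isCompact_univ.exists_isMaxOn (Set.univ_nonempty)
    ((map_continuous g).norm.continuousOn (s := Set.univ))
  refine (ContinuousMap.norm_le _ (norm_nonneg f)).mpr fun s => (ht (Set.mem_univ s)).trans ?_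
  change ‖g t‖ ≤ ‖f‖
  by_cases hgt : g t = 0
  · simp [hgt]
  have hx : (t : ℝ) ∈ Set.Ioo (0 : ℝ) 1 := by
    refine ⟨t.2.1.lt_of_ne fun h0 => hgt ?_, t.2.2.lt_of_ne fun h1 => hgt ?_⟩
    · rw [← show 0 = t from Subtype.ext h0, h.map_zero]
    · rw [show t = 1 from Subtype.ext h1, h.map_one]
  have hmax : IsLocalMax (fun x => extendIcc g x ^ 2) (t : ℝ) := by
    refine Eventually.of_forall fun y => ?_
    change extendIcc g y ^ 2 ≤ extendIcc g t ^ 2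
    rw [extendIcc_coe, sq_le_sq]
    exact ht (Set.mem_univ _)
  have hd := hmax.hasDerivAt_eq_zero ((h.hasDerivAt t hx).pow 2)
  simp only [extendIcc_coe] at hd
  have hgf : g t = f t := by
    have := hx.1.ne'
    simpa [hgt, hl, this, sub_eq_zero] using hd
  rw [hgf]
  exact f.norm_coe_le_norm t

end IsEulerSolution

lemma exists_isEulerSolution {S : Set ℝ} (hS : ∀ p ∈ S, 0 < p) {l : ℝ} (hl : 0 < l) (hlS : l ∉ S)
    {f : C(Set.Icc (0 : ℝ) 1, ℝ)} (hf : f ∈ Submodule.span ℝ (ePow '' S)) :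
    ∃ g ∈ Submodule.span ℝ (ePow '' insert l S), IsEulerSolution l f g := by
  induction hf using Submodule.span_induction with
  | mem f hf =>
    obtain ⟨p, hp, rfl⟩ := hf
    refine ⟨_, Submodule.smul_mem _ _ (Submodule.sub_mem _ ?_ ?_),
      .of_ePow (hS p hp) hl fun h => hlS (h ▸ hp)⟩
    · exact Submodule.subset_span ⟨l, Set.mem_insert _ _, rfl⟩
    · exact Submodule.subset_span ⟨p, Set.mem_insert_of_mem _ hp, rfl⟩
  | zero => exact ⟨0, Submodule.zero_mem _, .zero⟩
  | add f₁ f₂ _ _ h₁ h₂ =>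
    obtain ⟨g₁, hg₁, h₁⟩ := h₁
    obtain ⟨g₂, hg₂, h₂⟩ := h₂
    exact ⟨_, Submodule.add_mem _ hg₁ hg₂, h₁.add h₂⟩
  | smul c f _ h =>
    obtain ⟨g, hg, h⟩ := h
    exact ⟨_, Submodule.smul_mem _ c hg, h.smul c⟩

lemma exists_norm_ePow_sub_le_mul {S : Set ℝ} (hS : ∀ p ∈ S, 0 < p) {l q : ℝ} (hl : 0 < l)
    (hlS : l ∉ S) (hq : 0 < q) (hql : q ≠ l) {f : C(Set.Icc (0 : ℝ) 1, ℝ)}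
    (hf : f ∈ Submodule.span ℝ (ePow '' S)) :
    ∃ g ∈ Submodule.span ℝ (ePow '' insert l S),
      ‖ePow q - g‖ ≤ |1 - q / l| * ‖ePow q - f‖ := by
  obtain ⟨u, hu, hsol⟩ := exists_isEulerSolution hS hl hlS hf
  have hsol := (IsEulerSolution.of_ePow hq hl hql).add (hsol.smul (-1))
  refine ⟨ePow l + (1 - q / l) • u, Submodule.add_mem _
    (Submodule.subset_span ⟨l, Set.mem_insert _ _, rfl⟩) (Submodule.smul_mem _ _ hu), ?_⟩
  have hcoeff : (1 - q / l) * (l / (q - l)) = -1 := by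
    have := sub_ne_zero.mpr hql
    field_simp
    ring
  have hEq : ePow q - (ePow l + (1 - q / l) • u) =
      (1 - q / l) • ((l / (q - l)) • (ePow l - ePow q) + (-1 : ℝ) • u) := by
    rw [smul_add, smul_smul, hcoeff]
    module
  rw [hEq, norm_smul, Real.norm_eq_abs]
  refine mul_le_mul_of_nonneg_left ((hsol.norm_le hl.ne').trans_eq ?_) (abs_nonneg _)
  rw [neg_one_smul, ← sub_eq_add_neg]

lemma exists_norm_ePow_sub_le_prod {r : ℕ → ℝ} (hr : Function.Injective r) {q : ℝ} (hq : 0 < q)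
    (hqr : ∀ n, q < r n) (n : ℕ) :
    ∃ g ∈ Submodule.span ℝ (ePow '' (r '' Set.Iio n)),
      ‖ePow q - g‖ ≤ (∏ i ∈ Finset.range n, |1 - q / r i|) * ‖ePow q‖ := by
  induction n with
  | zero => exact ⟨0, Submodule.zero_mem _, by simp⟩
  | succ n ih =>
    obtain ⟨f, hf, hle⟩ := ih
    have hS : ∀ p ∈ r '' Set.Iio n, 0 < p := by
      rintro _ ⟨i, -, rfl⟩
      exact hq.trans (hqr i)
    have hn : r n ∉ r '' Set.Iio n := by
      rintro ⟨i, hi, hin⟩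
      exact (Set.mem_Iio.mp hi).ne (hr hin)
    obtain ⟨g, hg, hgle⟩ :=
      exists_norm_ePow_sub_le_mul hS (hq.trans (hqr n)) hn hq (hqr n).ne hf
    refine ⟨g, ?_, hgle.trans ?_⟩
    · rwa [← Set.image_insert_eq, ← Order.Iio_succ_eq_insert] at hg
    · rw [Finset.prod_range_succ, mul_comm _ |1 - q / r n|, mul_assoc]
      gcongr

lemma tendsto_prod_abs_one_sub_div {r : ℕ → ℝ} {q : ℝ} (hq : 0 < q) (hqr : ∀ n, q < r n)
    (hsum : ¬ Summable fun n => 1 / r n) :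
    Tendsto (fun n => ∏ i ∈ Finset.range n, |1 - q / r i|) atTop (𝓝 0) := by
  have hr : ∀ n, 0 < r n := fun n => hq.trans (hqr n)
  have hdiv : Tendsto (fun n => -(q * ∑ i ∈ Finset.range n, 1 / r i)) atTop atBot :=
    tendsto_neg_atTop_atBot.comp <| Tendsto.const_mul_atTop hq <|
      (not_summable_iff_tendsto_nat_atTop_of_nonneg fun n => (one_div_pos.mpr (hr n)).le).mp hsum
  refine squeeze_zero (fun n => Finset.prod_nonneg fun i _ => abs_nonneg _) (fun n => ?_)
    (Real.tendsto_exp_atBot.comp hdiv)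
  rw [Function.comp_apply, Finset.mul_sum, ← Finset.sum_neg_distrib, Real.exp_sum]
  refine Finset.prod_le_prod (fun i _ => abs_nonneg _) fun i _ => ?_
  rw [abs_of_nonneg (sub_nonneg.mpr ((div_le_one (hr i)).mpr (hqr i).le)), mul_one_div]
  linarith [Real.add_one_le_exp (-(q / r i))]

lemma ePow_mem_topologicalClosure_of_lt {r : ℕ → ℝ} (hr : Function.Injective r) {q : ℝ}
    (hq : 0 < q) (hqr : ∀ n, q < r n) (hsum : ¬ Summable fun n => 1 / r n) :
    ePow q ∈ (Submodule.span ℝ (Set.range fun n => ePow (r n))).topologicalClosure := by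
  choose g hg hle using exists_norm_ePow_sub_le_prod hr hq hqr
  refine mem_closure_of_tendsto (f := g) (b := atTop) ?_ (Eventually.of_forall fun n =>
    Submodule.span_mono ?_ (hg n))
  · rw [tendsto_iff_norm_sub_tendsto_zero]
    refine squeeze_zero (fun _ => norm_nonneg _)
      (fun n => (norm_sub_rev _ _).trans_le (hle n)) ?_
    simpa using (tendsto_prod_abs_one_sub_div hq hqr hsum).mul_const ‖ePow q‖
  · rintro _ ⟨_, ⟨i, -, rfl⟩, rfl⟩
    exact ⟨i, rfl⟩

lemma ePow_mem_topologicalClosure {r : ℕ → ℝ} (hr : Function.Injective r)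
    (htop : Tendsto r atTop atTop) (hsum : ¬ Summable fun n => 1 / r n) {q : ℝ} (hq : 0 < q) :
    ePow q ∈ (Submodule.span ℝ (Set.range fun n => ePow (r n))).topologicalClosure := by
  obtain ⟨N, hN⟩ := eventually_atTop.mp (htop.eventually_gt_atTop q)
  refine Submodule.topologicalClosure_mono (Submodule.span_mono ?_)
    (ePow_mem_topologicalClosure_of_lt (r := fun n => r (n + N))
      (hr.comp (add_left_injective N)) hq (fun n => hN _ (Nat.le_add_left _ _))
      (mt (summable_nat_add_iff (f := fun n => 1 / r n) N).mp hsum))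
  rintro _ ⟨n, rfl⟩
  exact ⟨n + N, rfl⟩

lemma eq_top_of_ePow_natCast_mem {V : Submodule ℝ C(Set.Icc (0 : ℝ) 1, ℝ)}
    (hV : IsClosed (V : Set C(Set.Icc (0 : ℝ) 1, ℝ))) (h : ∀ k : ℕ, ePow k ∈ V) : V = ⊤ := by
  have hpoly : (polynomialFunctions (Set.Icc (0 : ℝ) 1) : Set C(Set.Icc (0 : ℝ) 1, ℝ)) ⊆ V := by
    rintro _ ⟨P, -, rfl⟩
    change P.toContinuousMapOn _ ∈ V
    induction P using Polynomial.induction_on' with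
    | add P Q hP hQ =>
      have : (P + Q).toContinuousMapOn (Set.Icc (0 : ℝ) 1) =
          P.toContinuousMapOn _ + Q.toContinuousMapOn _ := by
        ext; simp
      exact this ▸ V.add_mem hP hQ
    | monomial k a =>
      have : (Polynomial.monomial k a).toContinuousMapOn (Set.Icc (0 : ℝ) 1) = a • ePow k := by
        ext; simp [ePow_apply]
      exact this ▸ V.smul_mem a (h k)
  refine eq_top_iff.mpr fun f _ => closure_minimal hpoly hV ?_
  have hf : f ∈ (polynomialFunctions (Set.Icc (0 : ℝ) 1)).topologicalClosure :=
    polynomialFunctions_closure_eq_top 0 1 ▸ Algebra.mem_top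
  exact hf

lemma dense_span_of_not_summable {r : ℕ → ℝ} (hr : Function.Injective r)
    (htop : Tendsto r atTop atTop) (hsum : ¬ Summable fun n => 1 / r n) :
    Dense (Submodule.span ℝ (insert (1 : C(Set.Icc (0 : ℝ) 1, ℝ))
      (Set.range fun n => ePow (r n))) : Set C(Set.Icc (0 : ℝ) 1, ℝ)) := by
  rw [Submodule.dense_iff_topologicalClosure_eq_top]
  refine eq_top_of_ePow_natCast_mem (Submodule.isClosed_topologicalClosure _) fun k => ?_
  rcases k.eq_zero_or_pos with rfl | hk
  · rw [Nat.cast_zero, ePow_zero]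
    exact Submodule.le_topologicalClosure _ (Submodule.subset_span (Set.mem_insert _ _))
  · exact Submodule.topologicalClosure_mono (Submodule.span_mono (Set.subset_insert _ _))
      (ePow_mem_topologicalClosure hr htop hsum (Nat.cast_pos.mpr hk))

/-- The quadratic form of the Cauchy matrix `1 / (P i + P j)`. -/
noncomputable def cauchyForm {ι : Type*} (s : Finset ι) (P a : ι → ℝ) : ℝ :=
  ∑ i ∈ s, ∑ j ∈ s, a i * a j / (P i + P j)

lemma cauchyForm_mul_le {ι : Type*} {s : Finset ι} {P : ι → ℝ} (hP : ∀ i, 0 < P i)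
    (a : ι → ℝ) {l : ℝ} (hl : 0 < l) :
    cauchyForm s P (fun i => (P i - l) / (P i + l) * a i) ≤ cauchyForm s P a := by
  have h : cauchyForm s P (fun i => (P i - l) / (P i + l) * a i) =
      cauchyForm s P a - 2 * l * (∑ i ∈ s, a i / (P i + l)) ^ 2 := by
    rw [sq, Finset.sum_mul_sum]
    simp only [cauchyForm, Finset.mul_sum, ← Finset.sum_sub_distrib]
    refine Finset.sum_congr rfl fun i _ => Finset.sum_congr rfl fun j _ => ?_
    have := hP i
    have := hP j
    field_simp
    ring
  rw [h]
  linarith [mul_nonneg (mul_pos two_pos hl).le (sq_nonneg (∑ i ∈ s, a i / (P i + l)))]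

lemma cauchyForm_prod_mul_le {ι : Type*} {s : Finset ι} {P : ι → ℝ} (hP : ∀ i, 0 < P i)
    (a : ι → ℝ) (t : Finset ι) :
    cauchyForm s P (fun i => (∏ j ∈ t, (P i - P j) / (P i + P j)) * a i) ≤ cauchyForm s P a := by
  classical
  induction t using Finset.induction_on with
  | empty => simp
  | insert k t hk ih =>
    refine le_trans ?_ ih
    simpa only [Finset.prod_insert hk, mul_assoc] using
      cauchyForm_mul_le hP (fun i => (∏ j ∈ t, (P i - P j) / (P i + P j)) * a i) (hP k)

lemma sq_prod_mul_div_le_cauchyForm {ι : Type*} [DecidableEq ι] {s : Finset ι} {P : ι → ℝ}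
    (hP : ∀ i, 0 < P i) (a : ι → ℝ) {k : ι} (hk : k ∈ s) :
    ((∏ j ∈ s.erase k, (P k - P j) / (P k + P j)) * a k) ^ 2 / (2 * P k) ≤ cauchyForm s P a := by
  refine le_trans (le_of_eq ?_) (cauchyForm_prod_mul_le hP a (s.erase k))
  have hzero : ∀ i ∈ s, i ≠ k → ∏ j ∈ s.erase k, (P i - P j) / (P i + P j) = 0 := fun i hi hik =>
    Finset.prod_eq_zero (Finset.mem_erase.mpr ⟨hik, hi⟩) (by simp)
  rw [cauchyForm, Finset.sum_eq_single_of_mem k hk, Finset.sum_eq_single_of_mem k hk, ← two_mul, sq]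
  · intro j hj hjk
    rw [hzero j hj hjk]
    simp
  · intro i hi hik
    simp [hzero i hi hik]

lemma cauchyForm_le_norm_sq {ι : Type*} {s : Finset ι} {p : ι → ℝ} (hp : ∀ i, 0 ≤ p i)
    (a : ι → ℝ) :
    cauchyForm s (fun i => p i + 1 / 2) a ≤ ‖∑ i ∈ s, a i • ePow (p i)‖ ^ 2 := by
  set F := ∑ i ∈ s, a i • ePow (p i) with hF
  have hterm : ∀ i j, ∫ x in (0 : ℝ)..1, a i * a j * x ^ (p i + p j) =
      a i * a j / (p i + 1 / 2 + (p j + 1 / 2)) := fun i j => by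
    have : 0 < p i + p j + 1 := by linarith [hp i, hp j]
    rw [intervalIntegral.integral_const_mul, integral_rpow (Or.inl (by linarith)),
      Real.one_rpow, Real.zero_rpow this.ne', sub_zero, mul_one_div]
    ring_nf
  have hint : ∀ i j, IntervalIntegrable (fun x : ℝ => a i * a j * x ^ (p i + p j))
      MeasureTheory.volume 0 1 := fun i j =>
    (intervalIntegral.intervalIntegrable_rpow' (by linarith [hp i, hp j])).const_mul _
  have hint_sum : ∀ i, IntervalIntegrable (fun x : ℝ => ∑ j ∈ s, a i * a j * x ^ (p i + p j))
      MeasureTheory.volume 0 1 := fun i => by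
    simpa only [Finset.sum_fn] using IntervalIntegrable.sum s fun j _ => hint i j
  have hint_sum_sum : IntervalIntegrable
      (fun x : ℝ => ∑ i ∈ s, ∑ j ∈ s, a i * a j * x ^ (p i + p j))
      MeasureTheory.volume 0 1 := by
    simpa only [Finset.sum_fn] using IntervalIntegrable.sum s fun i _ => hint_sum i
  have hform : cauchyForm s (fun i => p i + 1 / 2) a =
      ∫ x in (0 : ℝ)..1, ∑ i ∈ s, ∑ j ∈ s, a i * a j * x ^ (p i + p j) := by
    rw [intervalIntegral.integral_finsetSum fun i _ => hint_sum i]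
    refine Finset.sum_congr rfl fun i _ => ?_
    rw [intervalIntegral.integral_finsetSum fun j _ => hint i j]
    exact Finset.sum_congr rfl fun j _ => (hterm i j).symm
  have hsq : ∀ x ∈ Set.Icc (0 : ℝ) 1,
      ∑ i ∈ s, ∑ j ∈ s, a i * a j * x ^ (p i + p j) ≤ ‖F‖ ^ 2 := fun x hx => by
    have hFx : F ⟨x, hx⟩ = ∑ i ∈ s, a i * x ^ p i := by
      simp [hF, ContinuousMap.sum_apply, ePow_apply (hp _)]
    have : ∑ i ∈ s, ∑ j ∈ s, a i * a j * x ^ (p i + p j) = F ⟨x, hx⟩ ^ 2 := by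
      rw [hFx, sq, Finset.sum_mul_sum]
      refine Finset.sum_congr rfl fun i _ => Finset.sum_congr rfl fun j _ => ?_
      rw [Real.rpow_add_of_nonneg hx.1 (hp i) (hp j)]
      ring
    rw [this, ← sq_abs]
    exact pow_le_pow_left₀ (abs_nonneg _) (F.norm_coe_le_norm _) 2
  rw [hform]
  refine (intervalIntegral.integral_mono_on zero_le_one hint_sum_sum intervalIntegrable_const
    hsq).trans_eq ?_
  simp

lemma exp_neg_le_abs_sub_div_add {P Q : ℝ} (hP : 0 < P) (hQ : 0 < Q) (hPQ : P ≠ Q) :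
    Real.exp (-(2 * Q / |P - Q|)) ≤ |(Q - P) / (Q + P)| := by
  have hd : 0 < |P - Q| := abs_pos.mpr (sub_ne_zero.mpr hPQ)
  rw [abs_div, abs_sub_comm Q P, abs_of_pos (add_pos hQ hP), Real.exp_neg,
    ← inv_div (Q + P)]
  refine inv_anti₀ (by positivity) (le_trans ?_ (Real.add_one_le_exp _))
  rw [div_add_one hd.ne']
  exact div_le_div_of_nonneg_right (by linarith [le_abs_self (P - Q)]) hd.le

lemma exp_neg_tsum_le_norm_sq {p : ℕ → ℝ} (hp : ∀ n, 0 ≤ p n) {q : ℝ} (hq : 0 ≤ q)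
    (hqp : ∀ n, p n ≠ q) (hsum : Summable fun n => (2 * q + 1) / |p n - q|)
    {f : C(Set.Icc (0 : ℝ) 1, ℝ)}
    (hf : f ∈ Submodule.span ℝ (Set.range fun n => ePow (p n))) :
    Real.exp (-∑' n, (2 * q + 1) / |p n - q|) ^ 2 / (2 * q + 1) ≤ ‖f - ePow q‖ ^ 2 := by
  classical
  obtain ⟨c, rfl⟩ := Finsupp.mem_span_range_iff_exists_finsupp.mp hf
  let e : Option ℕ → ℝ := fun i => i.elim q p
  let a : Option ℕ → ℝ := fun i => i.elim (-1) c
  have he : ∀ i, 0 ≤ e i := by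
    rintro (_ | n)
    exacts [hq, hp n]
  have hF : (c.sum fun n x => x • ePow (p n)) - ePow q =
      ∑ i ∈ Finset.insertNone c.support, a i • ePow (e i) := by
    rw [Finset.sum_insertNone]
    simp only [a, e, Option.elim, Finsupp.sum]
    module
  have hlow := sq_prod_mul_div_le_cauchyForm (s := Finset.insertNone c.support)
    (P := fun i => e i + 1 / 2) (fun i => by linarith [he i]) a (k := none) (by simp)
  rw [hF]
  refine le_trans ?_ (hlow.trans (cauchyForm_le_norm_sq he a))
  have herase : (Finset.insertNone c.support).erase none = c.support.map .some := by
    ext (_ | n) <;> simp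
  rw [herase, Finset.prod_map, mul_pow, ← sq_abs (Finset.prod _ _), Finset.abs_prod]
  have hprod : Real.exp (-∑' n, (2 * q + 1) / |p n - q|) ≤
      ∏ n ∈ c.support, |(q + 1 / 2 - (p n + 1 / 2)) / (q + 1 / 2 + (p n + 1 / 2))| := by
    calc Real.exp (-∑' n, (2 * q + 1) / |p n - q|)
        ≤ Real.exp (∑ n ∈ c.support, -((2 * q + 1) / |p n - q|)) := by
          rw [Finset.sum_neg_distrib]
          gcongr
          exact hsum.sum_le_tsum _ fun n _ => by positivity
      _ ≤ _ := by
          rw [Real.exp_sum]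
          refine Finset.prod_le_prod (fun n _ => (Real.exp_pos _).le) fun n _ => ?_
          have h := exp_neg_le_abs_sub_div_add (P := p n + 1 / 2) (Q := q + 1 / 2)
            (by linarith [hp n]) (by linarith) (by simpa using hqp n)
          rwa [show 2 * (q + 1 / 2) = 2 * q + 1 by ring, add_sub_add_right_eq_sub] at h
  have h2 : 2 * (e none + 1 / 2) = 2 * q + 1 := by
    change 2 * (q + 1 / 2) = _
    ring
  have ha : a none ^ 2 = 1 := by simp [a]
  rw [h2, ha, mul_one]
  gcongr
  exact hprod

lemma not_dense_span_of_summable {r : ℕ → ℝ} (hpos : ∀ n, 0 < r n) (hmono : StrictMono r)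
    (hsum : Summable fun n => 1 / r n) :
    ¬ Dense (Submodule.span ℝ (insert (1 : C(Set.Icc (0 : ℝ) 1, ℝ))
      (Set.range fun n => ePow (r n))) : Set C(Set.Icc (0 : ℝ) 1, ℝ)) := by
  intro hdense
  let p : ℕ → ℝ := fun n => n.casesOn 0 r
  have hrange : insert (1 : C(Set.Icc (0 : ℝ) 1, ℝ)) (Set.range fun n => ePow (r n)) =
      Set.range fun n => ePow (p n) := by
    rw [← ePow_zero]
    ext f
    constructor
    · rintro (rfl | ⟨n, rfl⟩)
      exacts [⟨0, rfl⟩, ⟨n + 1, rfl⟩]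
    · rintro ⟨_ | n, rfl⟩
      exacts [Or.inl rfl, Or.inr ⟨n, rfl⟩]
  set q := r 0 / 2 with hqdef
  have hq : 0 < q := half_pos (hpos 0)
  have hqr : ∀ n, r n / 2 ≤ r n - q := fun n => by
    linarith [hmono.monotone (Nat.zero_le n)]
  have hp : ∀ n, 0 ≤ p n := by
    rintro (_ | n)
    exacts [le_rfl, (hpos n).le]
  have hqp : ∀ n, p n ≠ q := by
    rintro (_ | n)
    · exact hq.ne
    · exact (by linarith [hqr n, hpos n] : q < r n).ne'
  have hps : Summable fun n => (2 * q + 1) / |p n - q| := by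
    rw [← summable_nat_add_iff 1]
    refine .of_nonneg_of_le (fun n => by positivity) (fun n => ?_)
      (hsum.mul_left (2 * (2 * q + 1)))
    change (2 * q + 1) / |r n - q| ≤ _
    have := hpos n
    rw [abs_of_pos (by linarith [hqr n])]
    calc (2 * q + 1) / (r n - q) ≤ (2 * q + 1) / (r n / 2) := by
          gcongr
          exact hqr n
      _ = 2 * (2 * q + 1) * (1 / r n) := by
          field_simp
  rw [hrange] at hdense
  set δ := Real.exp (-∑' n, (2 * q + 1) / |p n - q|) ^ 2 / (2 * q + 1)
  have hδ : 0 < δ := by positivity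
  obtain ⟨f, hf, hfd⟩ := hdense.exists_dist_lt (ePow q) (Real.sqrt_pos.mpr hδ)
  have hle := exp_neg_tsum_le_norm_sq hp hq.le hqp hps hf
  rw [dist_comm, dist_eq_norm, Real.lt_sqrt (norm_nonneg _)] at hfd
  exact hfd.not_ge hle

/-- **Müntz theorem.** For a strictly increasing sequence of positive reals `r n → ∞`,
the span of the constant function `1` together with the functions `t ↦ t ^ (r n)` is dense in
`C([0,1], ℝ)` if and only if `∑ 1 / r n = ∞`. -/
theorem muntz_density (r : ℕ → ℝ) (hpos : ∀ n, 0 < r n) (hmono : StrictMono r)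
    (htop : Tendsto r atTop atTop) :
    Dense (↑(Submodule.span ℝ (insert (1 : C(Set.Icc (0:ℝ) 1, ℝ))
        (Set.range fun n => ePow (r n)))) : Set C(Set.Icc (0:ℝ) 1, ℝ)) ↔
      ¬ Summable (fun n => 1 / r n) := by
  refine ⟨fun hdense hsum => not_dense_span_of_summable hpos hmono hsum hdense,
    dense_span_of_not_summable hmono.injective htop⟩
end

section
/- Let 0 = r_0 < r_1 < ... < r_n < r_{n+1} be real numbers. Then for every k ∈ {0,...,n} and every t ∈ [0,1], H^n_{k,Λ_n}(t) = ((r_{n+1} − r_k)/r_{n+1}) · H^{n+1}_{k,Λ_{n+1}}(t) + (r_{k+1}/r_{n+1}) · H^{n+1}_{k+1,Λ_{n+1}}(t), where Λ_n = (r_0,...,r_n) and Λ_{n+1} = (r_0,...,r_{n+1}). -/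
open Filter Topology

/-- Divided difference of `g` at the `n+1` points `x 0, ..., x n`. -/
noncomputable def divDiff (g : ℝ → ℝ) : (n : ℕ) → (Fin (n+1) → ℝ) → ℝ
  | 0, x => g (x 0)
  | n+1, x => (divDiff g n (fun i => x i.succ) - divDiff g n (fun i => x i.castSucc)) /
      (x (Fin.last (n+1)) - x 0)

/-- Gelfond–Bernstein basis function `H^n_{k,Λ_n}` on `[0,1]` for the exponent sequence `r`.
Here `t ^ x` is the real power `Real.rpow`, so that for `t = 0` it agrees with the
function `f_0` of the paper: `0 ^ 0 = 1` and `0 ^ x = 0` for `x > 0`. -/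
noncomputable def gelfond (r : ℕ → ℝ) (n k : ℕ) (t : ℝ) : ℝ :=
  if k = n then t ^ (r n)
  else (-1 : ℝ)^(n-k) * (∏ j ∈ Finset.Icc (k+1) n, r j) *
    divDiff (fun x => t ^ x) (n-k) (fun i => r (k + i.val))

/-- The divided-difference formula for `gelfond` is also valid for the last index. -/
theorem gelfond_add (r : ℕ → ℝ) (k m : ℕ) (t : ℝ) :
    gelfond r (k + m) k t = (-1 : ℝ) ^ m * (∏ j ∈ Finset.Icc (k + 1) (k + m), r j) *
      divDiff (fun x => t ^ x) m (fun i => r (k + i.val)) := by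
  cases m with
  | zero => simp [gelfond, divDiff]
  | succ m =>
    rw [gelfond, if_neg (by omega), Nat.add_sub_cancel_left]

/-- The recursion for divided differences at consecutive terms of a sequence, without division. -/
theorem sub_mul_divDiff_succ (g : ℝ → ℝ) (r : ℕ → ℝ) (k m : ℕ) (h : r (k + m + 1) ≠ r k) :
    (r (k + m + 1) - r k) * divDiff g (m + 1) (fun i => r (k + i.val)) =
      divDiff g m (fun i => r (k + 1 + i.val)) - divDiff g m (fun i => r (k + i.val)) := by
  have h' : r (k + (m + 1)) - r k ≠ 0 := sub_ne_zero.2 h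
  simp only [divDiff, Fin.val_succ, Fin.val_castSucc, Fin.val_last, Fin.val_zero, add_zero]
  rw [add_assoc k m 1, mul_div_cancel₀ _ h']
  simp only [add_assoc, add_comm 1]

/-- Recurrence expressing `H^n_{k,Λ_n}` in terms of the Gelfond–Bernstein basis of the
next Müntz space: `H^n_k = ((r_{n+1} - r_k)/r_{n+1}) H^{n+1}_k + (r_{k+1}/r_{n+1}) H^{n+1}_{k+1}`. -/
theorem gelfond_recurrence (r : ℕ → ℝ) (n : ℕ) (hr0 : r 0 = 0)
    (hmono : ∀ i, i ≤ n → r i < r (i + 1)) :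
    ∀ k ≤ n, ∀ t ∈ Set.Icc (0:ℝ) 1,
      gelfond r n k t =
        ((r (n + 1) - r k) / r (n + 1)) * gelfond r (n + 1) k t +
          (r (k + 1) / r (n + 1)) * gelfond r (n + 1) (k + 1) t := by
  intro k hk t _
  have hlt : ∀ j ≤ n, r j < r (n + 1) := fun j hj => by
    induction hj using Nat.decreasingInduction with
    | self => exact hmono n le_rfl
    | of_succ i hi ih => exact (hmono i hi.le).trans ih
  have hpos : r (n + 1) ≠ 0 := (hr0 ▸ hlt 0 n.zero_le).ne'
  have hne : r (n + 1) ≠ r k := (hlt k hk).ne'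
  obtain ⟨m, rfl⟩ := Nat.exists_eq_add_of_le hk
  have hdiff := sub_mul_divDiff_succ (fun x => t ^ x) r k m hne
  have hlast : ∏ j ∈ Finset.Icc (k + 1) (k + m + 1), r j =
      (∏ j ∈ Finset.Icc (k + 1) (k + m), r j) * r (k + m + 1) :=
    Finset.prod_Icc_succ_top (by omega) r
  have hfirst : r (k + 1) * ∏ j ∈ Finset.Icc (k + 1 + 1) (k + m + 1), r j =
      ∏ j ∈ Finset.Icc (k + 1) (k + m + 1), r j := by
    rw [Finset.Icc_add_one_left_eq_Ioc, Finset.mul_prod_Ioc_eq_prod_Icc (by omega)]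
  have hleft := gelfond_add r k (m + 1) t
  have hright := gelfond_add r (k + 1) m t
  rw [← add_assoc] at hleft
  rw [add_right_comm k 1 m] at hright
  rw [gelfond_add, hleft, hright]
  rw [hlast] at hfirst ⊢
  field_simp
  rw [pow_succ]
  linear_combination
    (-1 : ℝ) ^ m * (∏ j ∈ Finset.Icc (k + 1) (k + m), r j) * r (k + m + 1) * hdiff -
    (-1 : ℝ) ^ m * divDiff (fun x => t ^ x) m (fun i => r (k + 1 + i.val)) * hfirst
end

section
/- Let 0 = r_0 < r_1 < ... < r_n be real numbers and Λ_n = (r_0,...,r_n). Then for every t ∈ [0,1]: (i) ∑_{k=0}^n H^n_{k,Λ_n}(t) = 1, and (ii) H^n_{k,Λ_n}(t) ≥ 0 for every k ∈ {0,...,n}. -/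
open Filter Topology

theorem divDiff_consecutive_succ (g : ℝ → ℝ) (r : ℕ → ℝ) (k m : ℕ) :
    divDiff g (m + 1) (fun i => r (k + i.val)) =
      (divDiff g m (fun i => r (k + 1 + i.val)) - divDiff g m (fun i => r (k + i.val))) /
        (r (k + m + 1) - r k) := by
  have h : (fun i : Fin (m + 1) => r (k + i.succ.val)) = fun i => r (k + 1 + i.val) := by
    funext i
    rw [Fin.val_succ, ← add_assoc, add_right_comm]
  rw [divDiff, h]
  rfl

theorem divDiff_const_mul (c : ℝ) (g : ℝ → ℝ) (n : ℕ) (x : Fin (n + 1) → ℝ) :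
    divDiff (fun y => c * g y) n x = c * divDiff g n x := by
  induction n with
  | zero => rfl
  | succ n ih => simp only [divDiff, ih]; ring

theorem divDiff_const (c : ℝ) (n : ℕ) (x : Fin (n + 2) → ℝ) :
    divDiff (fun _ => c) (n + 1) x = 0 := by
  induction n with
  | zero => simp [divDiff]
  | succ n ih => rw [divDiff, ih, ih, sub_self, zero_div]

theorem HasDerivAt.divDiff {F : ℝ → ℝ → ℝ} {F' : ℝ → ℝ} {t : ℝ}
    (h : ∀ y, HasDerivAt (fun s => F s y) (F' y) t) (n : ℕ) (x : Fin (n + 1) → ℝ) :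
    HasDerivAt (fun s => _root_.divDiff (F s) n x) (_root_.divDiff F' n x) t := by
  induction n with
  | zero => exact h _
  | succ n ih => exact ((ih _).sub (ih _)).div_const _

theorem continuous_divDiff_rpow (n : ℕ) (x : Fin (n + 1) → ℝ) (hx : ∀ i, 0 ≤ x i) :
    Continuous fun t : ℝ => divDiff (fun y => t ^ y) n x := by
  induction n with
  | zero => exact Real.continuous_rpow_const (hx 0)
  | succ n ih => exact ((ih _ fun i => hx _).sub (ih _ fun i => hx _)).div_const _

/-- Leibniz rule for the product of a function with the identity. -/
theorem divDiff_id_mul (g : ℝ → ℝ) {r : ℕ → ℝ} {n : ℕ} (hr : StrictMonoOn r (Set.Iic n))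
    (m k : ℕ) (hk : k + m + 1 ≤ n) :
    divDiff (fun y => y * g y) (m + 1) (fun i => r (k + i.val)) =
      r k * divDiff g (m + 1) (fun i => r (k + i.val)) +
        divDiff g m (fun i => r (k + 1 + i.val)) := by
  induction m generalizing k with
  | zero =>
    have h : r (k + 1) - r k ≠ 0 :=
      (sub_pos.2 (hr (Set.mem_Iic.2 (by omega)) (Set.mem_Iic.2 hk) (by omega))).ne'
    rw [divDiff_consecutive_succ, divDiff_consecutive_succ]
    simp only [divDiff, Fin.val_zero, add_zero]
    field_simp
    ring
  | succ m ih =>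
    have h : r (k + (m + 1) + 1) - r k ≠ 0 :=
      (sub_pos.2 (hr (Set.mem_Iic.2 (by omega)) (Set.mem_Iic.2 hk) (by omega))).ne'
    have h' : r (k + 1 + m + 1) - r (k + 1) ≠ 0 :=
      (sub_pos.2 (hr (Set.mem_Iic.2 (by omega)) (Set.mem_Iic.2 (by omega)) (by omega))).ne'
    have e := divDiff_consecutive_succ g r (k + 1) m
    rw [eq_div_iff h', show k + 1 + m + 1 = k + (m + 1) + 1 by ring] at e
    rw [divDiff_consecutive_succ, divDiff_consecutive_succ g, ih k (by omega),
      ih (k + 1) (by omega)]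
    field_simp
    linear_combination -e

theorem hasDerivAt_divDiff_rpow {r : ℕ → ℝ} {n : ℕ} (hr : StrictMonoOn r (Set.Iic n))
    {m k : ℕ} (hk : k + m + 1 ≤ n) {t : ℝ} (ht : 0 < t) :
    HasDerivAt (fun s : ℝ => divDiff (fun y => s ^ y) (m + 1) (fun i => r (k + i.val)))
      (t⁻¹ * (r k * divDiff (fun y => t ^ y) (m + 1) (fun i => r (k + i.val)) +
        divDiff (fun y => t ^ y) m (fun i => r (k + 1 + i.val)))) t := by
  rw [← divDiff_id_mul _ hr m k hk, ← divDiff_const_mul]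
  refine HasDerivAt.divDiff (fun y => ?_) _ _
  convert Real.hasDerivAt_rpow_const (p := y) (Or.inl ht.ne') using 1
  rw [Real.rpow_sub_one ht.ne']
  ring

theorem neg_one_pow_mul_divDiff_rpow_nonneg_of_pos {r : ℕ → ℝ} {n : ℕ}
    (hr : StrictMonoOn r (Set.Iic n)) (m k : ℕ) (hk : k + m ≤ n) {t : ℝ} (ht : 0 < t)
    (ht1 : t ≤ 1) :
    0 ≤ (-1) ^ m * divDiff (fun y => t ^ y) m (fun i => r (k + i.val)) := by
  induction m generalizing k t with
  | zero => simpa [divDiff] using Real.rpow_nonneg ht.le _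
  | succ m ih =>
    let φ : ℝ → ℝ := fun s => divDiff (fun y => s ^ y) (m + 1) (fun i => r (k + i.val))
    let h : ℝ → ℝ := fun s => s ^ (-r k) * ((-1) ^ (m + 1) * φ s)
    have hd : ∀ s, 0 < s → HasDerivAt h (-(s ^ (-r k) * s⁻¹ *
        ((-1) ^ m * divDiff (fun y => s ^ y) m (fun i => r (k + 1 + i.val))))) s := by
      intro s hs
      refine ((Real.hasDerivAt_rpow_const (p := -r k) (Or.inl hs.ne')).mul
        ((hasDerivAt_divDiff_rpow hr hk hs).const_mul ((-1) ^ (m + 1)))).congr_deriv ?_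
      rw [Real.rpow_sub_one hs.ne']
      ring
    have hanti : AntitoneOn h (Set.Icc t 1) := by
      have hpos : ∀ s ∈ Set.Icc t 1, 0 < s := fun s hs => ht.trans_le hs.1
      refine antitoneOn_of_deriv_nonpos (convex_Icc t 1)
        (fun s hs => (hd s (hpos s hs)).continuousAt.continuousWithinAt)
        (fun s hs => (hd s (hpos s (interior_subset hs))).differentiableAt.differentiableWithinAt)
        fun s hs => ?_
      have hs' := interior_subset hs
      have hs0 := hpos s hs'
      rw [(hd s hs0).deriv, neg_nonpos]
      exact mul_nonneg (by positivity) (ih (k + 1) (by omega) hs0 hs'.2)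
    have h1 : h 1 = 0 := by
      simp only [h, φ, Real.one_rpow, divDiff_const, mul_zero]
    have hle := hanti (Set.left_mem_Icc.2 ht1) (Set.right_mem_Icc.2 ht1) ht1
    rw [h1] at hle
    exact nonneg_of_mul_nonneg_right hle (Real.rpow_pos_of_pos ht _)

theorem neg_one_pow_mul_divDiff_rpow_nonneg {r : ℕ → ℝ} {n : ℕ} (hr0 : 0 ≤ r 0)
    (hr : StrictMonoOn r (Set.Iic n)) {m k : ℕ} (hk : k + m ≤ n) {t : ℝ}
    (ht : t ∈ Set.Icc (0 : ℝ) 1) :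
    0 ≤ (-1) ^ m * divDiff (fun y => t ^ y) m (fun i => r (k + i.val)) := by
  have hcont : Continuous fun s : ℝ =>
      (-1) ^ m * divDiff (fun y => s ^ y) m (fun i => r (k + i.val)) :=
    continuous_const.mul <| continuous_divDiff_rpow m _ fun i => hr0.trans <|
      hr.monotoneOn (Set.mem_Iic.2 n.zero_le) (Set.mem_Iic.2 (by omega)) (Nat.zero_le _)
  have hsub : Set.Ioc (0 : ℝ) 1 ⊆
      {s | 0 ≤ (-1) ^ m * divDiff (fun y => s ^ y) m (fun i => r (k + i.val))} :=
    fun s hs => neg_one_pow_mul_divDiff_rpow_nonneg_of_pos hr m k hk hs.1 hs.2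
  have := closure_minimal hsub (isClosed_le continuous_const hcont)
  rw [closure_Ioc zero_ne_one] at this
  exact this ht

theorem gelfond_eq (r : ℕ → ℝ) (n k : ℕ) (t : ℝ) :
    gelfond r n k t = (-1 : ℝ) ^ (n - k) * (∏ j ∈ Finset.Icc (k + 1) n, r j) *
      divDiff (fun x => t ^ x) (n - k) (fun i => r (k + i.val)) := by
  by_cases h : k = n
  · subst h
    rw [gelfond, if_pos rfl, Nat.sub_self]
    simp [divDiff]
  · rw [gelfond, if_neg h]

theorem gelfond_succ_sub {r : ℕ → ℝ} {n k : ℕ} (hk : k ≤ n) (h : r k < r (n + 1)) (t : ℝ) :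
    r (n + 1) * (gelfond r (n + 1) k t - gelfond r n k t) =
      r k * gelfond r (n + 1) k t - r (k + 1) * gelfond r (n + 1) (k + 1) t := by
  obtain ⟨m, rfl⟩ := Nat.exists_eq_add_of_le hk
  have e := divDiff_consecutive_succ (fun x => t ^ x) r k m
  rw [eq_div_iff (sub_pos.2 h).ne'] at e
  have hbot : ∏ j ∈ Finset.Icc (k + 1) (k + m + 1), r j =
      r (k + 1) * ∏ j ∈ Finset.Icc (k + 1 + 1) (k + m + 1), r j := by
    rw [← Finset.insert_Icc_add_one_left_eq_Icc (by omega), Finset.prod_insert (by simp)]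
  have htop : ∏ j ∈ Finset.Icc (k + 1) (k + m + 1), r j =
      (∏ j ∈ Finset.Icc (k + 1) (k + m), r j) * r (k + m + 1) :=
    Finset.prod_Icc_succ_top (by omega) _
  rw [gelfond_eq, gelfond_eq, gelfond_eq, show k + m + 1 - k = m + 1 by omega,
    show k + m - k = m by omega, show k + m + 1 - (k + 1) = m by omega, pow_succ]
  set D₁ := divDiff (fun x => t ^ x) m fun i => r (k + 1 + i.val)
  set D₀ := divDiff (fun x => t ^ x) m fun i => r (k + i.val)
  linear_combination (-(-1) ^ m * ∏ j ∈ Finset.Icc (k + 1) (k + m + 1), r j) * e +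
    (-(-1) ^ m * D₁) * hbot + ((-1) ^ m * D₀) * htop

theorem sum_gelfond {r : ℕ → ℝ} {n : ℕ} (hr0 : r 0 = 0) (hr : StrictMonoOn r (Set.Iic n))
    (t : ℝ) : ∑ k ∈ Finset.range (n + 1), gelfond r n k t = 1 := by
  induction n with
  | zero => simp [gelfond, hr0]
  | succ n ih =>
    have hlt : ∀ k ≤ n, r k < r (n + 1) := fun k hk =>
      hr (Set.mem_Iic.2 (by omega)) (Set.mem_Iic.2 le_rfl) (by omega)
    have hne : r (n + 1) ≠ 0 := (hr0 ▸ hlt 0 n.zero_le).ne'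
    have hsum := Finset.sum_congr (rfl : Finset.range (n + 1) = _) fun k hk =>
      gelfond_succ_sub (Finset.mem_range_succ_iff.1 hk)
        (hlt k (Finset.mem_range_succ_iff.1 hk)) t
    rw [Finset.sum_range_sub', ← Finset.mul_sum, Finset.sum_sub_distrib,
      ih (hr.mono (Set.Iic_subset_Iic.2 n.le_succ)), hr0] at hsum
    rw [Finset.sum_range_succ]
    refine mul_left_cancel₀ hne ?_
    linear_combination hsum

/-- The Gelfond–Bernstein basis is a nonnegative partition of unity on `[0,1]`. -/
theorem gelfond_partition_of_unity_nonneg (r : ℕ → ℝ) (n : ℕ) (hr0 : r 0 = 0)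
    (hmono : ∀ i, i < n → r i < r (i + 1)) :
    ∀ t ∈ Set.Icc (0:ℝ) 1,
      (∑ k ∈ Finset.range (n + 1), gelfond r n k t = 1) ∧
        (∀ k ≤ n, 0 ≤ gelfond r n k t) := by
  intro t ht
  have hr : StrictMonoOn r (Set.Iic n) :=
    strictMonoOn_Iic_of_lt_succ hmono
  refine ⟨sum_gelfond hr0 hr t, fun k hk => ?_⟩
  rw [gelfond_eq, mul_right_comm]
  refine mul_nonneg (neg_one_pow_mul_divDiff_rpow_nonneg hr0.ge hr (by omega) ht)
    (Finset.prod_nonneg fun j hj => ?_)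
  rw [← hr0]
  exact hr.monotoneOn (Set.mem_Iic.2 n.zero_le) (Set.mem_Iic.2 (Finset.mem_Icc.1 hj).2) j.zero_le
end

section
/- Let 0 = r_0 < r_1 < ... < r_n be real numbers and let 0 < a < b. Then there exists a unique family (B_0,...,B_n) of functions in the Müntz space E(Λ_n) = span(1, t^{r_1},...,t^{r_n}) such that ∑_{k=0}^n B_k(t) = 1 for all t ∈ [a,b], and for each k the derivatives B_k^{(j)}(a) = 0 for 0 ≤ j ≤ k−1 and B_k^{(j)}(b) = 0 for 0 ≤ j ≤ n−k−1. Moreover this family (the Chebyshev–Bernstein basis of E(Λ_n) on [a,b]) satisfies B_k(t) ≥ 0 for all t ∈ [a,b] and all k. -/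
open Filter Topology

/-- `f` belongs to the Müntz space `E(Λ_n) = span(t^{r_0}, t^{r_1}, ..., t^{r_n})`
(as a function of `t > 0`, where `t ^ r` is the real power). -/
def InMuntz (r : ℕ → ℝ) (n : ℕ) (f : ℝ → ℝ) : Prop :=
  ∃ c : ℕ → ℝ, ∀ t : ℝ, 0 < t → f t = ∑ j ∈ Finset.range (n + 1), c j * t ^ r j

/-- `B 0, ..., B n` is the Chebyshev–Bernstein basis of the Müntz space `E(Λ_n)` on `[a,b]`:
the functions belong to `E(Λ_n)`, sum to `1` on `[a,b]`, `B k` has a zero of order `k` at `a`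
(derivatives of order `j ≤ k - 1` vanish) and a zero of order `n - k` at `b`
(derivatives of order `j ≤ n - k - 1` vanish). -/
def IsChebBernstein (r : ℕ → ℝ) (n : ℕ) (a b : ℝ) (B : ℕ → ℝ → ℝ) : Prop :=
  (∀ k ≤ n, InMuntz r n (B k)) ∧
  (∀ t ∈ Set.Icc a b, ∑ k ∈ Finset.range (n + 1), B k t = 1) ∧
  (∀ k ≤ n, ∀ j < k, iteratedDeriv j (B k) a = 0) ∧
  (∀ k ≤ n, ∀ j < n - k, iteratedDeriv j (B k) b = 0)

lemma exists_finset_deriv_eq_zero {f : ℝ → ℝ} {a b : ℝ} (hf : ContinuousOn f (Set.Icc a b))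
    (s : Finset ℝ) (hs : ↑s ⊆ Set.Icc a b) (hzero : ∀ x ∈ s, f x = 0) :
    ∃ t : Finset ℝ, ↑t ⊆ Set.Ioo a b ∧ (∀ x ∈ t, deriv f x = 0) ∧ s.card ≤ t.card + 1 := by
  suffices H : ∃ t : Finset ℝ, (∀ x ∈ t, a < x ∧ ∃ y ∈ s, x < y) ∧
      (∀ x ∈ t, deriv f x = 0) ∧ s.card ≤ t.card + 1 by
    obtain ⟨t, ht, ht'⟩ := H
    refine ⟨t, fun x hx => ?_, ht'⟩
    obtain ⟨hax, y, hy, hxy⟩ := ht x hx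
    exact ⟨hax, hxy.trans_le (hs hy).2⟩
  induction s using Finset.induction_on_max with
  | empty => exact ⟨∅, by simp⟩
  | insert y s hmax ih =>
    have hsub : ↑s ⊆ Set.Icc a b := fun x hx => hs (Finset.mem_insert_of_mem hx)
    obtain ⟨t, ht, hd, hc⟩ := ih hsub fun x hx => hzero x (Finset.mem_insert_of_mem hx)
    have hys : y ∉ s := fun h => lt_irrefl _ (hmax y h)
    rcases s.eq_empty_or_nonempty with rfl | hne
    · exact ⟨∅, by simp⟩
    have hz := s.max'_mem hne
    set z := s.max' hne
    have hyI : y ∈ Set.Icc a b := hs (Finset.mem_insert_self y s)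
    obtain ⟨w, hw, hw0⟩ := exists_deriv_eq_zero (hmax z hz)
      (hf.mono (Set.Icc_subset_Icc (hsub hz).1 hyI.2))
      (by rw [hzero z (Finset.mem_insert_of_mem hz), hzero y (Finset.mem_insert_self y s)])
    have hwt : w ∉ t := fun h => by
      obtain ⟨-, v, hv, hwv⟩ := ht w h
      exact absurd (s.le_max' v hv) (not_le.2 (hw.1.trans hwv))
    refine ⟨insert w t, ?_, ?_, ?_⟩
    · intro x hx
      rcases Finset.mem_insert.1 hx with rfl | hx
      · exact ⟨(hsub hz).1.trans_lt hw.1, y, Finset.mem_insert_self y s, hw.2⟩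
      · obtain ⟨hax, v, hv, hxv⟩ := ht x hx
        exact ⟨hax, v, Finset.mem_insert_of_mem hv, hxv⟩
    · intro x hx
      rcases Finset.mem_insert.1 hx with rfl | hx
      · exact hw0
      · exact hd x hx
    · rw [Finset.card_insert_of_notMem hys, Finset.card_insert_of_notMem hwt]
      omega

lemma eventually_pos_right_of_iteratedDeriv_pos (k : ℕ) {f : ℝ → ℝ} {a : ℝ} (hf : AnalyticAt ℝ f a)
    (hzero : ∀ j < k, iteratedDeriv j f a = 0) (hpos : 0 < iteratedDeriv k f a) :
    ∀ᶠ t in 𝓝[>] a, 0 < f t := by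
  induction k generalizing f with
  | zero =>
    rw [iteratedDeriv_zero] at hpos
    exact (hf.continuousAt.eventually (lt_mem_nhds hpos)).filter_mono nhdsWithin_le_nhds
  | succ k ih =>
    have hderiv := ih hf.deriv
      (fun j hj => by rw [← iteratedDeriv_succ']; exact hzero _ (by omega))
      (by rwa [← iteratedDeriv_succ'])
    have hcont : ∀ᶠ t in 𝓝[≥] a, ContinuousAt f t :=
      (hf.eventually_analyticAt.mono fun t ht => ht.continuousAt).filter_mono nhdsWithin_le_nhds
    obtain ⟨u, hau, hu⟩ := mem_nhdsGT_iff_exists_Ioo_subset.1 hderiv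
    obtain ⟨v, hav, hv⟩ := mem_nhdsGE_iff_exists_Ico_subset.1 hcont
    have hfa : f a = 0 := by simpa using hzero 0 (by omega)
    filter_upwards [Ioo_mem_nhdsGT (lt_min hau hav)] with t ht
    have hmono : StrictMonoOn f (Set.Icc a t) := by
      refine strictMonoOn_of_deriv_pos (convex_Icc a t) (fun x hx => ?_) fun x hx => ?_
      · exact (hv ⟨hx.1, hx.2.trans_lt (ht.2.trans_le (min_le_right _ _))⟩).continuousWithinAt
      · rw [interior_Icc] at hx
        exact hu ⟨hx.1, hx.2.trans (ht.2.trans_le (min_le_left _ _))⟩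
    rw [← hfa]
    exact hmono (Set.left_mem_Icc.2 ht.1.le) (Set.right_mem_Icc.2 ht.1.le) ht.1

/-- The generalized polynomial `∑ i < N, c i * t ^ r i`. -/
noncomputable def muntzSum (r : ℕ → ℝ) (N : ℕ) (c : ℕ → ℝ) (t : ℝ) : ℝ :=
  ∑ i ∈ Finset.range N, c i * t ^ r i

lemma analyticAt_rpow_const {x : ℝ} (p : ℝ) (hx : 0 < x) :
    AnalyticAt ℝ (fun t : ℝ => t ^ p) x :=
  (Real.contDiffAt_rpow_const_of_ne hx.ne').analyticAt

lemma analyticAt_muntzSum (r : ℕ → ℝ) (N : ℕ) (c : ℕ → ℝ) {x : ℝ} (hx : 0 < x) :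
    AnalyticAt ℝ (muntzSum r N c) x :=
  Finset.analyticAt_fun_sum _ fun i _ => analyticAt_const.mul (analyticAt_rpow_const (r i) hx)

lemma iteratedDeriv_muntzSum (r : ℕ → ℝ) (N : ℕ) (c : ℕ → ℝ) (j : ℕ) {x : ℝ} (hx : 0 < x) :
    iteratedDeriv j (muntzSum r N c) x =
      ∑ i ∈ Finset.range N, c i * iteratedDeriv j (fun t : ℝ => t ^ r i) x := by
  unfold muntzSum
  rw [iteratedDeriv_fun_sum (f := fun i t => c i * t ^ r i) fun i _ =>
    (analyticAt_const.mul (analyticAt_rpow_const (r i) hx)).contDiffAt]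
  simp_rw [iteratedDeriv_const_mul_field]

lemma iteratedDeriv_muntzSum_sub (r : ℕ → ℝ) (N : ℕ) (c d : ℕ → ℝ) (j : ℕ) {x : ℝ} (hx : 0 < x) :
    iteratedDeriv j (muntzSum r N (c - d)) x =
      iteratedDeriv j (muntzSum r N c) x - iteratedDeriv j (muntzSum r N d) x := by
  simp_rw [iteratedDeriv_muntzSum r N _ j hx, Pi.sub_apply, sub_mul, Finset.sum_sub_distrib]

lemma muntzSum_sub (r : ℕ → ℝ) (N : ℕ) (c d : ℕ → ℝ) (x : ℝ) :
    muntzSum r N (c - d) x = muntzSum r N c x - muntzSum r N d x := by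
  simp_rw [muntzSum, Pi.sub_apply, sub_mul, Finset.sum_sub_distrib]

lemma muntzSum_congr (r : ℕ → ℝ) {N : ℕ} {c d : ℕ → ℝ} (h : ∀ i < N, c i = d i) :
    muntzSum r N c = muntzSum r N d :=
  funext fun _ => Finset.sum_congr rfl fun i hi => by rw [h i (Finset.mem_range.1 hi)]

lemma muntzSum_eq_zero (r : ℕ → ℝ) {N : ℕ} {c : ℕ → ℝ} (h : ∀ i < N, c i = 0) (t : ℝ) :
    muntzSum r N c t = 0 :=
  Finset.sum_eq_zero fun i hi => by rw [h i (Finset.mem_range.1 hi), zero_mul]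

lemma deriv_muntzSum (r : ℕ → ℝ) (hr0 : r 0 = 0) (N : ℕ) (c : ℕ → ℝ) {x : ℝ} (hx : 0 < x) :
    deriv (muntzSum r (N + 1) c) x =
      muntzSum (fun i => r (i + 1) - 1) N (fun i => c (i + 1) * r (i + 1)) x := by
  have h : HasDerivAt (muntzSum r (N + 1) c)
      (∑ i ∈ Finset.range (N + 1), c i * (r i * x ^ (r i - 1))) x :=
    HasDerivAt.fun_sum fun i _ => (Real.hasDerivAt_rpow_const (Or.inl hx.ne')).const_mul (c i)
  rw [h.deriv, Finset.sum_range_succ', hr0]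
  simp [muntzSum, mul_assoc]

lemma iteratedDeriv_mul_eq_zero {f g : ℝ → ℝ} {x : ℝ} (hf : AnalyticAt ℝ f x)
    (hg : AnalyticAt ℝ g x) {p : ℕ} (h : ∀ j < p, iteratedDeriv j g x = 0) :
    ∀ j < p, iteratedDeriv j (fun t => f t * g t) x = 0 := by
  intro j hj
  rw [iteratedDeriv_fun_mul hf.contDiffAt hg.contDiffAt]
  exact Finset.sum_eq_zero fun i _ => by rw [h (j - i) (by omega), mul_zero]

lemma exponent_zero_lt {r : ℕ → ℝ} {N : ℕ} (hr : ∀ i, i + 1 < N → r i < r (i + 1)) :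
    ∀ i, i + 1 < N → r 0 < r (i + 1)
  | 0, h => hr 0 h
  | i + 1, h => (exponent_zero_lt hr i (by omega)).trans (hr (i + 1) h)

lemma muntzSum_coeff_eq_zero (N : ℕ) (r : ℕ → ℝ) (hr : ∀ i, i + 1 < N → r i < r (i + 1))
    {a b : ℝ} (ha : 0 < a) (hab : a < b) (c : ℕ → ℝ) (p q : ℕ) (s : Finset ℝ)
    (hs : ↑s ⊆ Set.Ioo a b)
    (hpa : ∀ j < p, iteratedDeriv j (muntzSum r N c) a = 0)
    (hqb : ∀ j < q, iteratedDeriv j (muntzSum r N c) b = 0)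
    (hzero : ∀ x ∈ s, muntzSum r N c x = 0) (hN : N ≤ p + q + s.card) :
    ∀ i < N, c i = 0 := by
  induction N generalizing r c p q s with
  | zero => exact fun i hi => absurd hi (Nat.not_lt_zero i)
  | succ N ih =>
    have hb : 0 < b := ha.trans hab
    set r' : ℕ → ℝ := fun i => r i - r 0 with hr'
    set g := muntzSum r' (N + 1) c with hg
    have hgf : ∀ x, 0 < x → x ^ (-r 0) * muntzSum r (N + 1) c x = g x := fun x hx => by
      rw [hg, muntzSum, muntzSum, Finset.mul_sum]
      refine Finset.sum_congr rfl fun i _ => ?_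
      rw [mul_left_comm, ← Real.rpow_add hx, hr']
      ring_nf
    have hord : ∀ x, 0 < x → ∀ m : ℕ, (∀ j < m, iteratedDeriv j (muntzSum r (N + 1) c) x = 0) →
        ∀ j < m, iteratedDeriv j g x = 0 := fun x hx m h j hj => by
      have heq : (fun t => t ^ (-r 0) * muntzSum r (N + 1) c t) =ᶠ[𝓝 x] g :=
        (lt_mem_nhds hx).mono hgf
      rw [← heq.iteratedDeriv_eq]
      exact iteratedDeriv_mul_eq_zero (analyticAt_rpow_const _ hx)
        (analyticAt_muntzSum r (N + 1) c hx) h j hj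
    have hga := hord a ha p hpa
    have hgb := hord b hb q hqb
    have hgs : ∀ x ∈ s, g x = 0 := fun x hx => by
      rw [← hgf x (ha.trans (hs hx).1), hzero x hx, mul_zero]
    have hr'0 : r' 0 = 0 := sub_self _
    set r'' : ℕ → ℝ := fun i => r' (i + 1) - 1 with hr''
    set c' : ℕ → ℝ := fun i => c (i + 1) * r' (i + 1) with hc'
    have hderiv : ∀ x, 0 < x → deriv g x = muntzSum r'' N c' x := fun x hx =>
      deriv_muntzSum r' hr'0 N c hx
    have hord' : ∀ x, 0 < x → ∀ m : ℕ, (∀ j < m, iteratedDeriv j g x = 0) →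
        ∀ j < m - 1, iteratedDeriv j (muntzSum r'' N c') x = 0 := fun x hx m h j hj => by
      have heq : deriv g =ᶠ[𝓝 x] muntzSum r'' N c' := (lt_mem_nhds hx).mono hderiv
      rw [← heq.iteratedDeriv_eq, ← iteratedDeriv_succ']
      exact h _ (by omega)
    have hcont : ContinuousOn g (Set.Icc a b) := fun x hx =>
      (analyticAt_muntzSum r' (N + 1) c (ha.trans_le hx.1)).continuousAt.continuousWithinAt
    obtain ⟨z, hzI, hz0, hzcard⟩ : ∃ z : Finset ℝ, ↑z ⊆ Set.Icc a b ∧ (∀ x ∈ z, g x = 0) ∧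
        s.card + min p 1 + min q 1 ≤ z.card := by
      have has : a ∉ s := fun h => lt_irrefl a (hs h).1
      have hbs : b ∉ s := fun h => lt_irrefl b (hs h).2
      have hsI : ∀ x ∈ s, x ∈ Set.Icc a b := fun x hx => Set.Ioo_subset_Icc_self (hs hx)
      have hg0 : ∀ x, (∀ j < 1, iteratedDeriv j g x = 0) → g x = 0 := fun x h => by
        simpa using h 0 one_pos
      rcases Nat.eq_zero_or_pos p with hp | hp <;> rcases Nat.eq_zero_or_pos q with hq | hq
      · exact ⟨s, hsI, hgs, by omega⟩
      · refine ⟨insert b s, ?_, ?_, ?_⟩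
        · simpa [Set.insert_subset_iff, hab.le, Set.subset_def] using hsI
        · simpa using ⟨by simpa using hgb 0 hq, hgs⟩
        · rw [Finset.card_insert_of_notMem hbs]; omega
      · refine ⟨insert a s, ?_, ?_, ?_⟩
        · simpa [Set.insert_subset_iff, hab.le, Set.subset_def] using hsI
        · simpa using ⟨by simpa using hga 0 hp, hgs⟩
        · rw [Finset.card_insert_of_notMem has]; omega
      · refine ⟨insert a (insert b s), ?_, ?_, ?_⟩
        · simpa [Set.insert_subset_iff, hab.le, Set.subset_def] using hsI
        · simpa using ⟨by simpa using hga 0 hp, by simpa using hgb 0 hq, hgs⟩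
        · rw [Finset.card_insert_of_notMem (by simp [has, hab.ne]),
            Finset.card_insert_of_notMem hbs]
          omega
    obtain ⟨t, htI, ht0, htcard⟩ := exists_finset_deriv_eq_zero hcont z hzI hz0
    have hc'0 : ∀ i < N, c' i = 0 := by
      refine ih r'' (fun i hi => ?_) c' (p - 1) (q - 1) t htI (hord' a ha p hga)
        (hord' b hb q hgb) (fun x hx => ?_) (by omega)
      · simpa [hr'', hr'] using hr (i + 1) (by omega)
      · rw [← hderiv x (ha.trans (htI hx).1), ht0 x hx]
    have hcpos : ∀ i < N, c (i + 1) = 0 := fun i hi => by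
      have h := exponent_zero_lt hr i (by omega)
      exact (mul_eq_zero.1 (hc'0 i hi)).resolve_right (sub_pos.2 h).ne'
    obtain ⟨x, hx⟩ : z.Nonempty := Finset.card_pos.1 (by omega)
    have hc0 : c 0 = 0 := by
      have h := hz0 x hx
      rw [hg, muntzSum, Finset.sum_range_succ', Finset.sum_eq_zero fun i hi => by
        rw [hcpos i (Finset.mem_range.1 hi), zero_mul], hr'0] at h
      simpa using h
    rintro (_ | i) hi
    · exact hc0
    · exact hcpos i (by omega)

lemma iteratedDeriv_muntzSum_sum (r : ℕ → ℝ) (N : ℕ) {ι : Type*} (s : Finset ι) (c : ι → ℕ → ℝ)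
    (j : ℕ) {x : ℝ} (hx : 0 < x) :
    iteratedDeriv j (muntzSum r N (∑ l ∈ s, c l)) x =
      ∑ l ∈ s, iteratedDeriv j (muntzSum r N (c l)) x := by
  simp_rw [iteratedDeriv_muntzSum r N _ j hx, Finset.sum_apply, Finset.sum_mul]
  exact Finset.sum_comm

lemma muntzSum_single {r : ℕ → ℝ} (hr0 : r 0 = 0) (n : ℕ) (x : ℝ) :
    muntzSum r (n + 1) (Pi.single 0 1) x = 1 := by
  simp [muntzSum, Finset.sum_range_succ', hr0]

lemma exists_zero_mem_Ioo {f : ℝ → ℝ} {a b x y : ℝ} (hf : ContinuousOn f (Set.Icc a b))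
    (hy : y ∈ Set.Ioo a b) (hx : x ∈ Set.Icc a b) (hfy : 0 < f y) (hfx : f x < 0) :
    ∃ z ∈ Set.Ioo a b, f z = 0 := by
  have hsub : Set.uIcc y x ⊆ Set.Icc a b :=
    Set.uIcc_subset_Icc (Set.Ioo_subset_Icc_self hy) hx
  obtain ⟨z, hz, hz0⟩ := intermediate_value_uIcc (hf.mono hsub)
    (Set.mem_uIcc.2 (Or.inr ⟨hfx.le, hfy.le⟩))
  refine ⟨z, ?_, hz0⟩
  have hzx : z ≠ x := fun h => by rw [← h, hz0] at hfx; exact lt_irrefl _ hfx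
  rcases Set.mem_uIcc.1 hz with h | h
  · exact ⟨hy.1.trans_le h.1, (lt_of_le_of_ne h.2 hzx).trans_le hx.2⟩
  · exact ⟨hx.1.trans_lt (lt_of_le_of_ne h.1 hzx.symm), h.2.trans_lt hy.2⟩

/-- The coefficients `c` belong to the `k`-th tail sum `B k + ... + B n` of a Chebyshev–Bernstein
basis: the corresponding function has a zero of order `k` at `a`, and its difference with the
constant `1` has a zero of order `n + 1 - k` at `b`. -/
def IsTailCoeff (r : ℕ → ℝ) (n : ℕ) (a b : ℝ) (k : ℕ) (c : ℕ → ℝ) : Prop :=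
  (∀ j < k, iteratedDeriv j (muntzSum r (n + 1) c) a = 0) ∧
  (∀ j < n + 1 - k, iteratedDeriv j (muntzSum r (n + 1) (c - Pi.single 0 1)) b = 0)

section Tail

variable {r : ℕ → ℝ} {n : ℕ} {a b : ℝ} {k : ℕ} {c d : ℕ → ℝ}

lemma isTailCoeff_zero : IsTailCoeff r n a b 0 (Pi.single 0 1) := by
  refine ⟨fun j hj => absurd hj (Nat.not_lt_zero j), fun j _ => ?_⟩
  have h : muntzSum r (n + 1) (Pi.single 0 1 - Pi.single 0 1) = fun _ => 0 :=
    funext fun t => muntzSum_eq_zero r (by simp) t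
  rw [h, iteratedDeriv_const, ite_self]

lemma isTailCoeff_succ_self : IsTailCoeff r n a b (n + 1) 0 := by
  refine ⟨fun j _ => ?_, fun j hj => by omega⟩
  have h : muntzSum r (n + 1) 0 = fun _ => 0 :=
    funext fun t => muntzSum_eq_zero r (by simp) t
  simp [h]

lemma IsTailCoeff.unique (hmono : ∀ i, i < n → r i < r (i + 1)) (ha : 0 < a) (hab : a < b)
    (hk : k ≤ n + 1) (hc : IsTailCoeff r n a b k c) (hd : IsTailCoeff r n a b k d) :
    ∀ i < n + 1, c i = d i := by
  have hb : 0 < b := ha.trans hab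
  have h := muntzSum_coeff_eq_zero (n + 1) r (fun i hi => hmono i (by omega)) ha hab (c - d)
    k (n + 1 - k) ∅ (by simp)
    (fun j hj => by rw [iteratedDeriv_muntzSum_sub r _ _ _ j ha, hc.1 j hj, hd.1 j hj, sub_zero])
    (fun j hj => by
      rw [← sub_sub_sub_cancel_right c d (Pi.single 0 1), iteratedDeriv_muntzSum_sub r _ _ _ j hb,
        hc.2 j hj, hd.2 j hj, sub_zero])
    (by simp) (by simp; omega)
  exact fun i hi => sub_eq_zero.1 (h i hi)

lemma exists_isTailCoeff (hmono : ∀ i, i < n → r i < r (i + 1)) (ha : 0 < a) (hab : a < b)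
    (hk : k ≤ n + 1) : ∃ c, IsTailCoeff r n a b k c := by
  have hb : 0 < b := ha.trans hab
  let M : Matrix (Fin (n + 1)) (Fin (n + 1)) ℝ := fun i l =>
    if (i : ℕ) < k then iteratedDeriv i (fun t : ℝ => t ^ r l) a
    else iteratedDeriv (i - k) (fun t : ℝ => t ^ r l) b
  have hM : ∀ (c : ℕ → ℝ) (i : Fin (n + 1)), M.mulVec (fun l => c l) i =
      if (i : ℕ) < k then iteratedDeriv i (muntzSum r (n + 1) c) a
      else iteratedDeriv (i - k) (muntzSum r (n + 1) c) b := fun c i => by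
    rw [iteratedDeriv_muntzSum r _ _ _ ha, iteratedDeriv_muntzSum r _ _ _ hb, Finset.sum_range,
      Finset.sum_range]
    by_cases h : (i : ℕ) < k <;> simp [Matrix.mulVec, dotProduct, M, h, mul_comm]
  have hext : ∀ v : Fin (n + 1) → ℝ, ∃ c : ℕ → ℝ, v = fun l : Fin (n + 1) => c l := fun v =>
    ⟨fun i => if h : i < n + 1 then v ⟨i, h⟩ else 0, by ext l; simp only [l.2, dite_true]⟩
  have hinj : Function.Injective M.mulVec := by
    refine (injective_iff_map_eq_zero M.mulVecLin).2 fun v hv => ?_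
    obtain ⟨c, rfl⟩ := hext v
    have h0 : ∀ i, M.mulVec (fun l => c l) i = 0 := fun i => congrFun hv i
    have h := muntzSum_coeff_eq_zero (n + 1) r (fun i hi => hmono i (by omega)) ha hab c
      k (n + 1 - k) ∅ (by simp)
      (fun j hj => by simpa [hM, hj] using h0 ⟨j, by omega⟩)
      (fun j hj => by simpa [hM] using h0 ⟨k + j, by omega⟩)
      (by simp) (by simp; omega)
    exact funext fun l => h l l.2
  obtain ⟨v, hv⟩ := Matrix.mulVec_surjective_iff_isUnit.2 (Matrix.mulVec_injective_iff_isUnit.1 hinj)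
    fun i => if (i : ℕ) < k then 0
      else iteratedDeriv (i - k) (muntzSum r (n + 1) (Pi.single 0 1)) b
  obtain ⟨c, rfl⟩ := hext v
  refine ⟨c, fun j hj => ?_, fun j hj => ?_⟩
  · have h := congrFun hv ⟨j, by omega⟩
    simpa [hM, hj] using h
  · have h := congrFun hv ⟨k + j, by omega⟩
    rw [iteratedDeriv_muntzSum_sub r _ _ _ j hb, sub_eq_zero]
    simpa [hM] using h

lemma continuousOn_muntzSum (r : ℕ → ℝ) (N : ℕ) (c : ℕ → ℝ) (ha : 0 < a) :
    ContinuousOn (muntzSum r N c) (Set.Icc a b) := fun _ hx =>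
  (analyticAt_muntzSum r N c (ha.trans_le hx.1)).continuousAt.continuousWithinAt

lemma IsTailCoeff.apply_right (hr0 : r 0 = 0) (hk : k ≤ n)
    (hc : IsTailCoeff r n a b k c) : muntzSum r (n + 1) c b = 1 := by
  have h := hc.2 0 (by omega)
  rw [iteratedDeriv_zero, muntzSum_sub, muntzSum_single hr0] at h
  linarith

lemma IsTailCoeff.pos (hr0 : r 0 = 0) (hmono : ∀ i, i < n → r i < r (i + 1)) (ha : 0 < a)
    (hab : a < b) (hk : k ≤ n) (hc : IsTailCoeff r n a b k c) :
    ∀ x ∈ Set.Ioo a b, 0 < muntzSum r (n + 1) c x := by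
  have hb : 0 < b := ha.trans hab
  rcases Nat.eq_zero_or_pos k with rfl | hk0
  · intro x _
    rw [muntzSum_congr r (hc.unique hmono ha hab (by omega) isTailCoeff_zero), muntzSum_single hr0]
    exact one_pos
  have hSa : muntzSum r (n + 1) c a = 0 := by simpa using hc.1 0 hk0
  have hSb := hc.apply_right hr0 hk
  have hcont := continuousOn_muntzSum (b := b) r (n + 1) c ha
  have hne : ∀ x ∈ Set.Ioo a b, muntzSum r (n + 1) c x ≠ 0 := by
    intro x hx hx0
    obtain ⟨z, hz, hz0⟩ := exists_deriv_eq_zero hx.1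
      (hcont.mono (Set.Icc_subset_Icc_right hx.2.le)) (hSa.trans hx0.symm)
    have hderiv : ∀ (e : ℕ → ℝ) (y : ℝ), 0 < y → deriv (muntzSum r (n + 1) e) =ᶠ[𝓝 y]
        muntzSum (fun i => r (i + 1) - 1) n (fun i => e (i + 1) * r (i + 1)) := fun e y hy =>
      (lt_mem_nhds hy).mono fun t ht => deriv_muntzSum r hr0 n e ht
    have hcoeff := muntzSum_coeff_eq_zero n (fun i => r (i + 1) - 1)
      (fun i hi => by simpa using hmono (i + 1) hi) ha hab (fun i => c (i + 1) * r (i + 1))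
      (k - 1) (n - k) {z} (by simpa using ⟨hz.1, hz.2.trans hx.2⟩)
      (fun j hj => by
        rw [← (hderiv c a ha).iteratedDeriv_eq, ← iteratedDeriv_succ']
        exact hc.1 _ (by omega))
      (fun j hj => by
        have h := hc.2 (j + 1) (by omega)
        rw [iteratedDeriv_succ', (hderiv _ b hb).iteratedDeriv_eq] at h
        simpa using h)
      (fun y hy => by
        rw [Finset.mem_singleton.1 hy, ← (hderiv c z (ha.trans hz.1)).eq_of_nhds, hz0])
      (by simp; omega)
    have hconst : ∀ y ∈ Set.Ioo a b, deriv (muntzSum r (n + 1) c) y = 0 := fun y hy => by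
      rw [(hderiv c y (ha.trans hy.1)).eq_of_nhds, muntzSum_eq_zero _ hcoeff]
    obtain ⟨y, hy, hy'⟩ := exists_deriv_eq_slope (muntzSum r (n + 1) c) hab hcont fun y hy =>
      (analyticAt_muntzSum r _ c (ha.trans hy.1)).differentiableAt.differentiableWithinAt
    rw [hconst y hy, hSa, hSb] at hy'
    have : b - a ≠ 0 := (sub_pos.2 hab).ne'
    field_simp at hy'
    norm_num at hy'
  intro x hx
  by_contra! hneg
  obtain ⟨z, hz, hz0⟩ := exists_zero_mem_Ioo hcont.neg hx (Set.right_mem_Icc.2 hab.le)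
    (neg_pos.2 (lt_of_le_of_ne hneg (hne x hx))) (by simp [hSb])
  exact hne z hz (neg_eq_zero.1 hz0)

lemma IsTailCoeff.sub_nonneg (hr0 : r 0 = 0) (hmono : ∀ i, i < n → r i < r (i + 1)) (ha : 0 < a)
    (hab : a < b) (hk : k ≤ n) (hc : IsTailCoeff r n a b k c)
    (hd : IsTailCoeff r n a b (k + 1) d) :
    ∀ x ∈ Set.Icc a b, 0 ≤ muntzSum r (n + 1) (c - d) x := by
  have hb : 0 < b := ha.trans hab
  intro x hx
  by_contra! hneg
  have hnonzero : ∀ (p : ℕ) (s : Finset ℝ), ↑s ⊆ Set.Ioo a b →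
      (∀ j < p, iteratedDeriv j (muntzSum r (n + 1) (c - d)) a = 0) →
      (∀ y ∈ s, muntzSum r (n + 1) (c - d) y = 0) → p + s.card < k + 1 := by
    intro p s hs hp hs0
    by_contra! hcard
    have h := muntzSum_coeff_eq_zero (n + 1) r (fun i hi => hmono i (by omega)) ha hab (c - d)
      p (n - k) s hs hp
      (fun j hj => by
        rw [← sub_sub_sub_cancel_right c d (Pi.single 0 1),
          iteratedDeriv_muntzSum_sub r _ _ _ j hb, hc.2 j (by omega), hd.2 j (by omega), sub_zero])
      hs0 (by omega)
    exact hneg.ne (muntzSum_eq_zero r h x)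
  have hk0 : ∀ j < k, iteratedDeriv j (muntzSum r (n + 1) (c - d)) a = 0 := fun j hj => by
    rw [iteratedDeriv_muntzSum_sub r _ _ _ j ha, hc.1 j hj, hd.1 j (by omega), sub_zero]
  have hlead : iteratedDeriv k (muntzSum r (n + 1) (c - d)) a =
      iteratedDeriv k (muntzSum r (n + 1) c) a := by
    rw [iteratedDeriv_muntzSum_sub r _ _ _ k ha, hd.1 k (by omega), sub_zero]
  have hnegc : ∀ j, iteratedDeriv j (muntzSum r (n + 1) (0 - c)) a =
      -iteratedDeriv j (muntzSum r (n + 1) c) a := fun j => by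
    rw [iteratedDeriv_muntzSum_sub r _ _ _ j ha, iteratedDeriv_muntzSum r _ 0 j ha]
    simp
  have hIoo : ∀ᶠ y in 𝓝[>] a, y ∈ Set.Ioo a b := Ioo_mem_nhdsGT hab
  rcases lt_trichotomy (iteratedDeriv k (muntzSum r (n + 1) (c - d)) a) 0 with h | h | h
  · have hev := eventually_pos_right_of_iteratedDeriv_pos k
      (analyticAt_muntzSum r (n + 1) (0 - c) ha)
      (fun j hj => by rw [hnegc, hc.1 j hj, neg_zero])
      (by rw [hnegc, ← hlead]; linarith)
    obtain ⟨y, hy, hyI⟩ := (hev.and hIoo).exists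
    have hpos := hc.pos hr0 hmono ha hab hk y hyI
    rw [muntzSum_sub, muntzSum_eq_zero r (c := 0) (by simp)] at hy
    linarith
  · have := hnonzero (k + 1) ∅ (by simp)
      (fun j hj => (Nat.lt_succ_iff_lt_or_eq.1 hj).elim (hk0 j) fun hjk => hjk ▸ h) (by simp)
    simp at this
  · have hev := eventually_pos_right_of_iteratedDeriv_pos k
      (analyticAt_muntzSum r (n + 1) (c - d) ha) hk0 h
    obtain ⟨y, hy, hyI⟩ := (hev.and hIoo).exists
    obtain ⟨z, hz, hz0⟩ := exists_zero_mem_Ioo (continuousOn_muntzSum r (n + 1) (c - d) ha)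
      hyI hx hy hneg
    have := hnonzero k {z} (by simpa using hz) hk0 (by simpa using hz0)
    simp at this

end Tail

lemma IsChebBernstein.exists_tailCoeff {r : ℕ → ℝ} {n : ℕ} {a b : ℝ} {B : ℕ → ℝ → ℝ}
    (hr0 : r 0 = 0) (hmono : ∀ i, i < n → r i < r (i + 1)) (ha : 0 < a) (hab : a < b)
    (hB : IsChebBernstein r n a b B) :
    ∃ C : ℕ → ℕ → ℝ, (∀ k ≤ n + 1, IsTailCoeff r n a b k (C k)) ∧
      ∀ k ≤ n, ∀ t, 0 < t → B k t = muntzSum r (n + 1) (C k - C (k + 1)) t := by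
  have hb : 0 < b := ha.trans hab
  obtain ⟨hmem, hsum, hBa, hBb⟩ := hB
  choose! c hc using hmem
  have hder : ∀ l ≤ n, ∀ j x, 0 < x →
      iteratedDeriv j (muntzSum r (n + 1) (c l)) x = iteratedDeriv j (B l) x := by
    intro l hl j x hx
    have heq : B l =ᶠ[𝓝 x] muntzSum r (n + 1) (c l) := (lt_mem_nhds hx).mono (hc l hl)
    exact (heq.iteratedDeriv_eq j).symm
  set C : ℕ → ℕ → ℝ := fun k => ∑ l ∈ Finset.Ico k (n + 1), c l with hC
  obtain ⟨s, hs, hscard⟩ := (Set.Ioo_infinite hab).exists_subset_card_eq (n + 1)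
  have hC0 : ∀ i < n + 1, (C 0 - Pi.single 0 1 : ℕ → ℝ) i = 0 := by
    refine muntzSum_coeff_eq_zero (n + 1) r (fun i hi => hmono i (by omega)) ha hab _ 0 0 s hs
      (by simp) (by simp) (fun x hx => ?_) (by omega)
    have hx0 : 0 < x := ha.trans (hs hx).1
    have h := iteratedDeriv_muntzSum_sum r (n + 1) (Finset.Ico 0 (n + 1)) c 0 hx0
    simp only [iteratedDeriv_zero] at h
    rw [muntzSum_sub, muntzSum_single hr0, h, ← Finset.range_eq_Ico, sub_eq_zero,
      ← hsum x (Set.Ioo_subset_Icc_self (hs hx))]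
    exact Finset.sum_congr rfl fun l hl =>
      (hc l (Nat.lt_succ_iff.1 (Finset.mem_range.1 hl)) x hx0).symm
  refine ⟨C, fun k hk => ⟨fun j hj => ?_, fun j hj => ?_⟩, fun k hk t ht => ?_⟩
  · rw [hC, iteratedDeriv_muntzSum_sum r _ _ _ j ha]
    refine Finset.sum_eq_zero fun l hl => ?_
    rw [Finset.mem_Ico] at hl
    rw [hder l (by omega) j a ha, hBa l (by omega) j (by omega)]
  · have hcongr : muntzSum r (n + 1) (C k - Pi.single 0 1) = muntzSum r (n + 1) (C k - C 0) :=
      muntzSum_congr r fun i hi => by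
        have := hC0 i hi
        simp only [Pi.sub_apply] at this ⊢
        linarith
    have hsplit : C 0 = ∑ l ∈ Finset.range k, c l + C k := by
      rw [hC, Finset.range_eq_Ico]
      exact (Finset.sum_Ico_consecutive c (Nat.zero_le k) hk).symm
    have hzero : iteratedDeriv j (muntzSum r (n + 1) (C 0 - C k)) b = 0 := by
      rw [hsplit, add_sub_cancel_right, iteratedDeriv_muntzSum_sum r _ _ _ j hb]
      refine Finset.sum_eq_zero fun l hl => ?_
      rw [Finset.mem_range] at hl
      rw [hder l (by omega) j b hb, hBb l (by omega) j (by omega)]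
    rw [iteratedDeriv_muntzSum_sub r _ _ _ j hb] at hzero
    rw [hcongr, iteratedDeriv_muntzSum_sub r _ _ _ j hb]
    linarith
  · rw [hc k hk t ht]
    have : C k - C (k + 1) = c k := by
      rw [hC]
      simp only [Finset.sum_eq_sum_Ico_succ_bot (Nat.lt_succ_of_le hk), add_sub_cancel_right]
    rw [this, muntzSum]

/-- Existence, uniqueness (as functions on `[a,b]`) and nonnegativity of the
Chebyshev–Bernstein basis of a Müntz space `E(Λ_n)` on an interval `[a,b]` with `0 < a < b`. -/
theorem chebBernstein_exists_unique_nonneg (r : ℕ → ℝ) (n : ℕ) (hr0 : r 0 = 0)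
    (hmono : ∀ i, i < n → r i < r (i + 1)) (a b : ℝ) (ha : 0 < a) (hab : a < b) :
    (∃ B : ℕ → ℝ → ℝ, IsChebBernstein r n a b B ∧
      (∀ B' : ℕ → ℝ → ℝ, IsChebBernstein r n a b B' →
        ∀ k ≤ n, Set.EqOn (B' k) (B k) (Set.Icc a b))) ∧
    (∀ B : ℕ → ℝ → ℝ, IsChebBernstein r n a b B →
      ∀ k ≤ n, ∀ t ∈ Set.Icc a b, 0 ≤ B k t) := by
  have hb : 0 < b := ha.trans hab
  choose! C hC using fun k (hk : k ≤ n + 1) => exists_isTailCoeff hmono ha hab hk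
  refine ⟨⟨fun k => muntzSum r (n + 1) (C k - C (k + 1)), ⟨?_, ?_, ?_, ?_⟩, ?_⟩, ?_⟩
  · exact fun k _ => ⟨C k - C (k + 1), fun t _ => rfl⟩
  · intro t _
    simp_rw [muntzSum_sub]
    rw [Finset.sum_range_sub' fun k => muntzSum r (n + 1) (C k) t,
      muntzSum_congr r ((hC 0 (by omega)).unique hmono ha hab (by omega) isTailCoeff_zero),
      muntzSum_congr r ((hC _ le_rfl).unique hmono ha hab le_rfl isTailCoeff_succ_self),
      muntzSum_single hr0, muntzSum_eq_zero r (by simp), sub_zero]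
  · intro k hk j hj
    rw [iteratedDeriv_muntzSum_sub r _ _ _ j ha, (hC k (by omega)).1 j hj,
      (hC (k + 1) (by omega)).1 j (by omega), sub_zero]
  · intro k hk j hj
    change iteratedDeriv j (muntzSum r (n + 1) (C k - C (k + 1))) b = 0
    rw [← sub_sub_sub_cancel_right _ _ (Pi.single 0 1), iteratedDeriv_muntzSum_sub r _ _ _ j hb,
      (hC k (by omega)).2 j (by omega), (hC (k + 1) (by omega)).2 j (by omega), sub_zero]
  · intro B' hB' k hk t ht
    obtain ⟨C', hC', hB'C'⟩ := hB'.exists_tailCoeff hr0 hmono ha hab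
    rw [hB'C' k hk t (ha.trans_le ht.1)]
    refine congrFun (muntzSum_congr r fun i hi => ?_) t
    rw [Pi.sub_apply, Pi.sub_apply,
      (hC' k (by omega)).unique hmono ha hab (by omega) (hC k (by omega)) i hi,
      (hC' (k + 1) (by omega)).unique hmono ha hab (by omega) (hC (k + 1) (by omega)) i hi]
  · intro B hB k hk t ht
    obtain ⟨C', hC', hBC'⟩ := hB.exists_tailCoeff hr0 hmono ha hab
    rw [hBC' k hk t (ha.trans_le ht.1)]
    exact (hC' k (by omega)).sub_nonneg hr0 hmono ha hab hk (hC' (k + 1) (by omega)) t ht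
end

section
/- Let 0 = r_0 < r_1 < ... < r_n be real numbers and Λ_n = (r_0,...,r_n). For each a ∈ (0,1) let (B^a_0,...,B^a_n) be the Chebyshev–Bernstein basis of E(Λ_n) on [a,1], i.e. functions in E(Λ_n) with ∑_{k=0}^n B^a_k ≡ 1 on [a,1], (B^a_k)^{(j)}(a) = 0 for 0 ≤ j ≤ k−1, and (B^a_k)^{(j)}(1) = 0 for 0 ≤ j ≤ n−k−1. Then for every k ∈ {0,...,n} and every t ∈ (0,1], lim_{a→0⁺} B^a_k(t) = H^n_{k,Λ_n}(t). -/
open Filter Topology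

open Polynomial in
/-- Newton's form of the interpolation polynomial: adding a node adds a multiple of the nodal
polynomial of the old nodes. -/
theorem interpolate_insert_eq_add_nodal {ι : Type*} [DecidableEq ι] {s : Finset ι} {i : ι}
    (hi : i ∉ s) {v : ι → ℝ} (hv : Set.InjOn v (insert i s : Finset ι)) (g : ι → ℝ) :
    Lagrange.interpolate (insert i s) v g = Lagrange.interpolate s v g +
      C ((Lagrange.interpolate (insert i s) v g).coeff s.card) * Lagrange.nodal s v := by
  set P := Lagrange.interpolate (insert i s) v g with hP
  rw [← sub_eq_iff_eq_add]
  apply Lagrange.eq_interpolate_of_eval_eq g (hv.mono (by simp))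
  · rw [Polynomial.degree_lt_iff_coeff_zero]
    intro m hm
    rcases hm.eq_or_lt with rfl | hm
    · have h1 : (Lagrange.nodal s v).coeff s.card = 1 := by
        have := (Lagrange.nodal_monic (s := s) (v := v)).coeff_natDegree
        rwa [Lagrange.natDegree_nodal] at this
      simp [h1]
    · have h1 : P.coeff m = 0 := by
        apply Polynomial.coeff_eq_zero_of_degree_lt
        refine (Lagrange.degree_interpolate_lt g hv).trans_le ?_
        rw [Finset.card_insert_of_notMem hi]
        exact_mod_cast hm
      have h2 : (Lagrange.nodal s v).coeff m = 0 := by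
        apply Polynomial.coeff_eq_zero_of_natDegree_lt
        rwa [Lagrange.natDegree_nodal]
      simp [h1, h2]
  · intro j hj
    rw [eval_sub, eval_mul, Lagrange.eval_nodal_at_node hj, mul_zero, sub_zero, hP,
      Lagrange.eval_interpolate_at_node g hv (Finset.mem_insert_of_mem hj)]

open Polynomial in
/-- A divided difference is the leading coefficient of the interpolation polynomial. -/
theorem divDiff_eq_coeff_interpolate (g : ℝ → ℝ) (r : ℕ → ℝ) (m : ℕ) : ∀ k : ℕ,
    Set.InjOn r (Finset.Ico k (k + m + 1)) →
    divDiff g m (fun i => r (k + i.val)) =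
      (Lagrange.interpolate (Finset.Ico k (k + m + 1)) r (fun i => g (r i))).coeff m := by
  induction m with
  | zero => intro k _; simp [divDiff]
  | succ m ih =>
    intro k hr
    have hk : k ∈ Finset.Ico k (k + (m + 1) + 1) := by simp
    have hl : k + (m + 1) ∈ Finset.Ico k (k + (m + 1) + 1) := by simp
    have hne : k ≠ k + (m + 1) := by omega
    have hrne : r k ≠ r (k + (m + 1)) := fun h => hne (hr hk hl h)
    have e1 : (Finset.Ico k (k + (m + 1) + 1)).erase (k + (m + 1)) = Finset.Ico k (k + m + 1) := by
      ext; simp; omega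
    have e2 : (Finset.Ico k (k + (m + 1) + 1)).erase k = Finset.Ico (k + 1) (k + 1 + m + 1) := by
      ext; simp; omega
    have s1 : Set.InjOn r (Finset.Ico k (k + m + 1)) :=
      hr.mono (by rw [← e1]; exact_mod_cast Finset.erase_subset _ _)
    have s2 : Set.InjOn r (Finset.Ico (k + 1) (k + 1 + m + 1)) :=
      hr.mono (by rw [← e2]; exact_mod_cast Finset.erase_subset _ _)
    have key : ∀ (s : Finset ℕ) (x y : ℝ), Set.InjOn r s → s.card = m + 1 →
        (Lagrange.interpolate s r (fun i => g (r i)) * Lagrange.basisDivisor x y).coeff (m + 1) =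
          (Lagrange.interpolate s r (fun i => g (r i))).coeff m * (x - y)⁻¹ := by
      intro s x y hs hc
      have h0 : (Lagrange.interpolate s r (fun i => g (r i))).coeff (m + 1) = 0 := by
        apply Polynomial.coeff_eq_zero_of_degree_lt
        simpa [hc] using Lagrange.degree_interpolate_lt (fun i => g (r i)) hs
      rw [Lagrange.basisDivisor, mul_left_comm, coeff_C_mul, mul_sub, coeff_sub, coeff_mul_X,
        coeff_mul_C, h0]
      ring
    have i1 := ih k s1
    have i2 := ih (k + 1) s2
    rw [Lagrange.interpolate_eq_add_interpolate_erase _ hr hk hl hne, coeff_add, e1, e2,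
      key _ _ _ s1 (by simp; omega), key _ _ _ s2 (by simp; omega), ← i1, ← i2]
    have f1 : (fun i : Fin (m + 1) => r (k + (i.succ : Fin (m + 2)).val)) =
        fun i => r (k + 1 + i.val) := by
      funext i; congr 1; simp; omega
    have h3 : r (k + (m + 1)) - r k ≠ 0 := sub_ne_zero.2 hrne.symm
    have h4 : r k - r (k + (m + 1)) ≠ 0 := sub_ne_zero.2 hrne
    simp only [divDiff, f1, Fin.val_castSucc, Fin.val_last, Fin.val_zero, add_zero]
    field_simp
    ring

/-- The Gelfond–Bernstein basis functions are differences of values at `0` of consecutive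
interpolation polynomials of `x ↦ t ^ x`. -/
theorem gelfond_eq_eval_interpolate_sub {r : ℕ → ℝ} {n k : ℕ} (hr : Set.InjOn r (Set.Iic n))
    (hk : k ≤ n) (t : ℝ) :
    gelfond r n k t =
      (Lagrange.interpolate (Finset.Ico k (n + 1)) r (fun i => t ^ r i)).eval 0 -
      (Lagrange.interpolate (Finset.Ico (k + 1) (n + 1)) r (fun i => t ^ r i)).eval 0 := by
  have hins : insert k (Finset.Ico (k + 1) (n + 1)) = Finset.Ico k (n + 1) := by
    ext; simp; omega
  have hinj : Set.InjOn r (Finset.Ico k (n + 1)) := hr.mono fun i hi => by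
    simp at hi ⊢; omega
  have h := interpolate_insert_eq_add_nodal (s := Finset.Ico (k + 1) (n + 1)) (i := k) (by simp)
    (v := r) (by rwa [hins]) (fun i => t ^ r i)
  have hd := divDiff_eq_coeff_interpolate (fun x => t ^ x) r (n - k) k
    (by rwa [show k + (n - k) + 1 = n + 1 by omega])
  rw [show k + (n - k) + 1 = n + 1 by omega] at hd
  rw [hins, show (Finset.Ico (k + 1) (n + 1)).card = n - k by simp, ← hd] at h
  rw [h, Polynomial.eval_add, add_sub_cancel_left, Polynomial.eval_mul, Polynomial.eval_C,
    Lagrange.eval_nodal, gelfond]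
  split_ifs with hkn
  · subst hkn; simp [hd]
  · have : ∏ i ∈ Finset.Ico (k + 1) (n + 1), (0 - r i) =
        (-1) ^ (n - k) * ∏ j ∈ Finset.Icc (k + 1) n, r j := by
      simp only [zero_sub]
      rw [Finset.prod_neg]
      simp
      rfl
    rw [this]
    ring

open Polynomial in
theorem iteratedDeriv_sum_mul_rpow {ι : Type*} (s : Finset ι) (c r : ι → ℝ) (m : ℕ) :
    ∀ x : ℝ, 0 < x → iteratedDeriv m (fun t => ∑ j ∈ s, c j * t ^ r j) x =
      ∑ j ∈ s, c j * (descPochhammer ℝ m).eval (r j) * x ^ (r j - m) := by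
  induction m with
  | zero => intro x _; simp
  | succ m ih =>
    intro x hx
    have hev : iteratedDeriv m (fun t => ∑ j ∈ s, c j * t ^ r j) =ᶠ[𝓝 x]
        fun x => ∑ j ∈ s, c j * (descPochhammer ℝ m).eval (r j) * x ^ (r j - m) := by
      filter_upwards [lt_mem_nhds hx] with y hy using ih y hy
    rw [iteratedDeriv_succ, hev.deriv_eq]
    refine HasDerivAt.deriv (HasDerivAt.fun_sum fun j _ => ?_)
    refine ((Real.hasDerivAt_rpow_const (p := r j - m) (Or.inl hx.ne')).const_mul
      (c j * (descPochhammer ℝ m).eval (r j))).congr_deriv ?_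
    rw [descPochhammer_succ_eval]
    push_cast
    rw [sub_add_eq_sub_sub]
    ring

open Polynomial in
/-- A zero of order `N` of a generalized polynomial is detected by the Euler operator
`t d/dt`. -/
theorem sum_mul_eval_eq_zero_of_iteratedDeriv_eq_zero {ι : Type*} (s : Finset ι) (c r : ι → ℝ)
    {x : ℝ} (hx : 0 < x) {N : ℕ}
    (h : ∀ m < N, iteratedDeriv m (fun t => ∑ j ∈ s, c j * t ^ r j) x = 0) :
    ∀ q : ℝ[X], q.degree < N → ∑ j ∈ s, c j * x ^ r j * q.eval (r j) = 0 := by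
  induction N with
  | zero =>
    intro q hq
    have : q = 0 := by simpa using hq
    simp [this]
  | succ N ih =>
    intro q hq
    have h1 := h N (Nat.lt_succ_self N)
    rw [iteratedDeriv_sum_mul_rpow s c r N x hx] at h1
    have h2 : ∑ j ∈ s, c j * x ^ r j * (descPochhammer ℝ N).eval (r j) = 0 := by
      have h3 : x ^ (N : ℝ) * ∑ j ∈ s, c j * (descPochhammer ℝ N).eval (r j) * x ^ (r j - N) =
          0 := by rw [h1, mul_zero]
      rw [← h3, Finset.mul_sum]
      refine Finset.sum_congr rfl fun j _ => ?_
      rw [Real.rpow_sub hx]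
      have := (Real.rpow_pos_of_pos hx (N : ℝ)).ne'
      field_simp
    have hlead : (descPochhammer ℝ N).coeff N = 1 := by
      have := (monic_descPochhammer ℝ N).coeff_natDegree
      rwa [descPochhammer_natDegree] at this
    have h4 := ih (fun m hm => h m (hm.trans (Nat.lt_succ_self N)))
      (q - C (q.coeff N) * descPochhammer ℝ N) (by
        rw [Polynomial.degree_lt_iff_coeff_zero] at hq ⊢
        intro m hm
        rcases hm.eq_or_lt with rfl | hm
        · simp [hlead]
        · have : (descPochhammer ℝ N).coeff m = 0 := by
            apply Polynomial.coeff_eq_zero_of_natDegree_lt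
            rwa [descPochhammer_natDegree]
          simp [this, hq m hm])
    calc ∑ j ∈ s, c j * x ^ r j * q.eval (r j)
        = ∑ j ∈ s, c j * x ^ r j * (q - C (q.coeff N) * descPochhammer ℝ N).eval (r j) +
          q.coeff N * ∑ j ∈ s, c j * x ^ r j * (descPochhammer ℝ N).eval (r j) := by
          rw [Finset.mul_sum, ← Finset.sum_add_distrib]
          refine Finset.sum_congr rfl fun j _ => ?_
          simp only [eval_sub, eval_mul, eval_C]
          ring
      _ = 0 := by rw [h4, h2, mul_zero, add_zero]

/-- Functions `t ↦ t ^ r j` with distinct exponents are linearly independent on any open set. -/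
theorem eq_zero_of_sum_mul_rpow_eventuallyEq_zero {ι : Type*} [DecidableEq ι] (s : Finset ι)
    (c r : ι → ℝ)
    (hr : Set.InjOn r s) {x : ℝ} (hx : 0 < x)
    (h : (fun t => ∑ j ∈ s, c j * t ^ r j) =ᶠ[𝓝 x] fun _ => 0) : ∀ j ∈ s, c j = 0 := by
  intro j hj
  have h1 := sum_mul_eval_eq_zero_of_iteratedDeriv_eq_zero s c r hx (N := s.card)
    (fun m _ => by rw [h.iteratedDeriv_eq]; simp)
    (Lagrange.basis s r j) (by
      rw [Lagrange.degree_basis hr hj]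
      exact_mod_cast Nat.sub_lt (Finset.card_pos.2 ⟨j, hj⟩) one_pos)
  rw [Finset.sum_eq_single_of_mem j hj fun i hi hij => by
    rw [Lagrange.eval_basis_of_ne hij.symm hi, mul_zero], Lagrange.eval_basis_self hr hj,
    mul_one] at h1
  exact (mul_eq_zero.1 h1).resolve_right (Real.rpow_pos_of_pos hx _).ne'

/-- Solutions of linear systems `x + E x = v` converge to `v` as `E → 0`. -/
theorem tendsto_of_eq_sub_sum_mul {ι α : Type*} (s : Finset ι) (l : Filter α) (x : α → ι → ℝ)
    (E : α → ι → ι → ℝ) (v : ι → ℝ)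
    (hE : ∀ i ∈ s, ∀ j ∈ s, Tendsto (fun a => E a i j) l (𝓝 0))
    (h : ∀ᶠ a in l, ∀ i ∈ s, x a i = v i - ∑ j ∈ s, E a i j * x a j) :
    ∀ i ∈ s, Tendsto (fun a => x a i) l (𝓝 (v i)) := by
  set ε : α → ℝ := fun a => ∑ i ∈ s, ∑ j ∈ s, |E a i j| with hε
  set M : α → ℝ := fun a => ∑ j ∈ s, |x a j| with hM
  set V : ℝ := ∑ j ∈ s, |v j| with hV
  have hε0 : Tendsto ε l (𝓝 0) := by
    have : Tendsto ε l (𝓝 (∑ i ∈ s, ∑ j ∈ s, |(0 : ℝ)|)) :=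
      tendsto_finsetSum _ fun i hi => tendsto_finsetSum _ fun j hj => (hE i hi j hj).abs
    simpa using this
  have hrow : ∀ a, ∀ i ∈ s, |∑ j ∈ s, E a i j * x a j| ≤ (∑ j ∈ s, |E a i j|) * M a := by
    intro a i hi
    refine (Finset.abs_sum_le_sum_abs _ _).trans ?_
    rw [Finset.sum_mul]
    refine Finset.sum_le_sum fun j hj => ?_
    rw [abs_mul]
    exact mul_le_mul_of_nonneg_left
      (Finset.single_le_sum (f := fun j => |x a j|) (fun _ _ => abs_nonneg _) hj) (abs_nonneg _)
  have hM0 : ∀ a, 0 ≤ M a := fun a => Finset.sum_nonneg fun _ _ => abs_nonneg _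
  have hbound : ∀ᶠ a in l, M a ≤ 2 * V := by
    filter_upwards [h, hε0.eventually (gt_mem_nhds (show (0 : ℝ) < 1 / 2 by norm_num))] with a ha hea
    have : M a ≤ V + ε a * M a := by
      rw [hV, hε, Finset.sum_mul, ← Finset.sum_add_distrib]
      refine Finset.sum_le_sum fun i hi => ?_
      rw [ha i hi]
      exact (abs_sub _ _).trans (add_le_add_right (hrow a i hi) _)
    nlinarith [hM0 a]
  intro i hi
  rw [tendsto_iff_norm_sub_tendsto_zero]
  refine squeeze_zero' (Eventually.of_forall fun _ => norm_nonneg _)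
    (g := fun a => ε a * (2 * V)) ?_ (by simpa using hε0.mul_const (2 * V))
  filter_upwards [h, hbound] with a ha hb
  rw [Real.norm_eq_abs, ha i hi, sub_sub_cancel_left, abs_neg]
  refine (hrow a i hi).trans (mul_le_mul ?_ hb (hM0 a)
    (Finset.sum_nonneg fun _ _ => Finset.sum_nonneg fun _ _ => abs_nonneg _))
  exact Finset.single_le_sum (f := fun i => ∑ j ∈ s, |E a i j|)
    (fun _ _ => Finset.sum_nonneg fun _ _ => abs_nonneg _) hi

open Polynomial in
/-- If `∑ e a j t ^ r j` has a zero of order `k` at `a`, and takes the value `1` to order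
`n + 1 - k` at `1`, then it tends to the value at `0` of the polynomial interpolating
`x ↦ t ^ x` at `r k, …, r n`. -/
theorem tendsto_sum_mul_rpow_eval_interpolate {r : ℕ → ℝ} {n k : ℕ}
    (hr : StrictMonoOn r (Set.Iic n)) (hk : k ≤ n + 1) (e : ℝ → ℕ → ℝ)
    (hzero : ∀ a ∈ Set.Ioo (0 : ℝ) 1, ∀ q : ℝ[X], q.degree < k →
      ∑ j ∈ Finset.range (n + 1), e a j * a ^ r j * q.eval (r j) = 0)
    (hone : ∀ a ∈ Set.Ioo (0 : ℝ) 1, ∀ q : ℝ[X], q.degree < (n + 1 - k : ℕ) →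
      ∑ j ∈ Finset.range (n + 1), e a j * q.eval (r j) = q.eval 0) (t : ℝ) :
    Tendsto (fun a => ∑ j ∈ Finset.range (n + 1), e a j * t ^ r j) (𝓝[Set.Ioo 0 1] 0)
      (𝓝 ((Lagrange.interpolate (Finset.Ico k (n + 1)) r (fun i => t ^ r i)).eval 0)) := by
  set lo := Finset.range k with hlo
  set hi := Finset.Ico k (n + 1) with hhi
  have hsplit : ∀ f : ℕ → ℝ, ∑ j ∈ Finset.range (n + 1), f j = ∑ j ∈ lo, f j + ∑ j ∈ hi, f j :=
    fun f => (Finset.sum_range_add_sum_Ico f hk).symm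
  have injlo : Set.InjOn r lo := hr.injOn.mono fun i h => by simp [hlo] at h ⊢; omega
  have injhi : Set.InjOn r hi := hr.injOn.mono fun i h => by simp [hhi] at h ⊢; omega
  have hlow : ∀ a ∈ Set.Ioo (0 : ℝ) 1, ∀ j ∈ lo, e a j =
      ∑ i ∈ hi, -((Lagrange.basis lo r j).eval (r i) * a ^ (r i - r j)) * e a i := by
    intro a ha j hj
    have h := hzero a ha (Lagrange.basis lo r j) (by
      rw [Lagrange.degree_basis injlo hj]
      have : 0 < k := Nat.pos_of_ne_zero (by rintro rfl; simp [hlo] at hj)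
      simp only [hlo, Finset.card_range]
      exact_mod_cast Nat.sub_lt this one_pos)
    rw [hsplit, Finset.sum_eq_single_of_mem j hj fun i hi hij => by
      rw [Lagrange.eval_basis_of_ne hij.symm hi, mul_zero], Lagrange.eval_basis_self injlo hj,
      mul_one] at h
    have hpos := (Real.rpow_pos_of_pos ha.1 (r j)).ne'
    have h' : e a j * a ^ r j =
        -∑ i ∈ hi, e a i * a ^ r i * (Lagrange.basis lo r j).eval (r i) := by linarith
    rw [← mul_left_inj' hpos, h', Finset.sum_mul, ← Finset.sum_neg_distrib]
    refine Finset.sum_congr rfl fun i _ => ?_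
    rw [Real.rpow_sub ha.1]
    field_simp
  have hpow : ∀ j ∈ lo, ∀ i ∈ hi,
      Tendsto (fun a : ℝ => a ^ (r i - r j)) (𝓝[Set.Ioo 0 1] 0) (𝓝 0) := by
    intro j hj i hi'
    have hlt : r j < r i := by
      simp only [hlo, hhi, Finset.mem_range, Finset.mem_Ico] at hj hi'
      exact hr (by simp; omega) (by simp; omega) (by omega)
    have := (Real.continuousAt_rpow_const 0 (r i - r j) (Or.inr (sub_pos.2 hlt).le)).tendsto
    rw [Real.zero_rpow (sub_pos.2 hlt).ne'] at this
    exact this.mono_left nhdsWithin_le_nhds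
  have hhigh : ∀ i ∈ hi, Tendsto (fun a => e a i) (𝓝[Set.Ioo 0 1] 0)
      (𝓝 ((Lagrange.basis hi r i).eval 0)) := by
    refine tendsto_of_eq_sub_sum_mul hi _ e
      (fun a i i' => ∑ j ∈ lo, (Lagrange.basis hi r i).eval (r j) *
        -((Lagrange.basis lo r j).eval (r i') * a ^ (r i' - r j)))
      (fun i => (Lagrange.basis hi r i).eval 0) ?_ ?_
    · intro i _ i' hi'
      have : Tendsto (fun a : ℝ => ∑ j ∈ lo, (Lagrange.basis hi r i).eval (r j) *
          -((Lagrange.basis lo r j).eval (r i') * a ^ (r i' - r j))) (𝓝[Set.Ioo 0 1] 0)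
          (𝓝 (∑ j ∈ lo, (Lagrange.basis hi r i).eval (r j) *
            -((Lagrange.basis lo r j).eval (r i') * 0))) :=
        tendsto_finsetSum _ fun j hj => (((hpow j hj i' hi').const_mul _).neg).const_mul _
      simpa using this
    · filter_upwards [self_mem_nhdsWithin] with a ha i hii
      have h := hone a ha (Lagrange.basis hi r i) (by
        rw [Lagrange.degree_basis injhi hii]
        have : 0 < n + 1 - k := by simp [hhi] at hii; omega
        simp only [hhi, Nat.card_Ico]
        exact_mod_cast Nat.sub_lt this one_pos)
      rw [hsplit, Finset.sum_eq_single_of_mem (s := hi) i hii fun i' hi' hij => by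
        rw [Lagrange.eval_basis_of_ne hij.symm hi', mul_zero], Lagrange.eval_basis_self injhi hii,
        mul_one] at h
      rw [← h, eq_sub_iff_add_eq, add_comm, add_left_inj]
      simp only [Finset.sum_mul]
      rw [Finset.sum_comm]
      refine Finset.sum_congr rfl fun j hj => ?_
      rw [hlow a ha j hj, Finset.sum_mul]
      refine Finset.sum_congr rfl fun i' _ => ?_
      ring
  have hlow0 : ∀ j ∈ lo, Tendsto (fun a => e a j) (𝓝[Set.Ioo 0 1] 0) (𝓝 0) := by
    intro j hj
    have : Tendsto (fun a => ∑ i ∈ hi,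
        -((Lagrange.basis lo r j).eval (r i) * a ^ (r i - r j)) * e a i) (𝓝[Set.Ioo 0 1] 0)
        (𝓝 (∑ i ∈ hi, -((Lagrange.basis lo r j).eval (r i) * 0) *
          (Lagrange.basis hi r i).eval 0)) :=
      tendsto_finsetSum _ fun i hi' => (((hpow j hj i hi').const_mul _).neg).mul (hhigh i hi')
    simp only [mul_zero, neg_zero, zero_mul, Finset.sum_const_zero] at this
    refine this.congr' ?_
    filter_upwards [self_mem_nhdsWithin] with a ha using (hlow a ha j hj).symm
  simp only [hsplit]
  have hfin : Tendsto
      (fun a => ∑ j ∈ lo, e a j * t ^ r j + ∑ j ∈ hi, e a j * t ^ r j) (𝓝[Set.Ioo 0 1] 0)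
      (𝓝 (∑ j ∈ lo, 0 * t ^ r j + ∑ j ∈ hi, (Lagrange.basis hi r j).eval 0 * t ^ r j)) :=
    (tendsto_finsetSum _ fun j hj => (hlow0 j hj).mul_const _).add
      (tendsto_finsetSum _ fun j hj => (hhigh j hj).mul_const _)
  convert hfin using 2
  simp [Lagrange.interpolate_apply, eval_finsetSum, mul_comm]

open Polynomial in
/-- The tail sums of a Chebyshev–Bernstein basis on `[a, 1]`, in coefficients: they vanish to order
`k` at `a`, and are equal to `1` to order `n + 1 - k` at `1`. -/
theorem IsChebBernstein.exists_coeff {r : ℕ → ℝ} {n : ℕ} (hr0 : r 0 = 0)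
    (hr : StrictMonoOn r (Set.Iic n)) {a : ℝ} (ha : a ∈ Set.Ioo (0 : ℝ) 1) {B : ℕ → ℝ → ℝ}
    (hB : IsChebBernstein r n a 1 B) :
    ∃ c : ℕ → ℕ → ℝ,
      (∀ k ≤ n, ∀ t, 0 < t → B k t = ∑ j ∈ Finset.range (n + 1), c k j * t ^ r j) ∧
      (∀ k ≤ n + 1, ∀ q : ℝ[X], q.degree < k →
        ∑ j ∈ Finset.range (n + 1),
          (∑ i ∈ Finset.Ico k (n + 1), c i j) * a ^ r j * q.eval (r j) = 0) ∧
      (∀ k ≤ n + 1, ∀ q : ℝ[X], q.degree < (n + 1 - k : ℕ) →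
        ∑ j ∈ Finset.range (n + 1),
          (∑ i ∈ Finset.Ico k (n + 1), c i j) * q.eval (r j) = q.eval 0) := by
  obtain ⟨hspan, hsum, hleft, hright⟩ := hB
  choose! c hc using hspan
  have hev : ∀ k ≤ n, ∀ x : ℝ, 0 < x →
      B k =ᶠ[𝓝 x] fun t => ∑ j ∈ Finset.range (n + 1), c k j * t ^ r j := fun k hk x hx => by
    filter_upwards [lt_mem_nhds hx] with y hy using hc k hk y hy
  have hinj : Set.InjOn r (Finset.range (n + 1)) := hr.injOn.mono fun i h => by
    simp at h ⊢; omega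
  have htot : ∀ j ∈ Finset.range (n + 1),
      ∑ i ∈ Finset.range (n + 1), c i j - (if j = 0 then 1 else 0) = 0 := by
    have hx : (a + 1) / 2 ∈ Set.Ioo a 1 := ⟨by linarith [ha.2], by linarith [ha.2]⟩
    refine eq_zero_of_sum_mul_rpow_eventuallyEq_zero (Finset.range (n + 1)) _ r hinj
      (ha.1.trans hx.1) ?_
    filter_upwards [isOpen_Ioo.mem_nhds hx] with t ht
    have h1 := hsum t ⟨ht.1.le, ht.2.le⟩
    rw [Finset.sum_congr rfl fun k hk =>
      hc k (Nat.lt_succ_iff.1 (Finset.mem_range.1 hk)) t (ha.1.trans ht.1), Finset.sum_comm] at h1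
    simp only [sub_mul, Finset.sum_sub_distrib, Finset.sum_mul, h1]
    simp [hr0]
  refine ⟨c, hc, fun k hk q hq => ?_, fun k hk q hq => ?_⟩
  · simp only [Finset.sum_mul]
    rw [Finset.sum_comm]
    refine Finset.sum_eq_zero fun i hi => ?_
    obtain ⟨hki, hin⟩ := Finset.mem_Ico.1 hi
    refine sum_mul_eval_eq_zero_of_iteratedDeriv_eq_zero _ (c i) r ha.1 (N := k)
      (fun m hm => ?_) q hq
    rw [← (hev i (by omega) a ha.1).iteratedDeriv_eq]
    exact hleft i (by omega) m (by omega)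
  · have hlow : ∀ i ∈ Finset.range k,
        ∑ j ∈ Finset.range (n + 1), c i j * q.eval (r j) = 0 := fun i hi => by
      have hik := Finset.mem_range.1 hi
      have := sum_mul_eval_eq_zero_of_iteratedDeriv_eq_zero (Finset.range (n + 1)) (c i) r one_pos
        (N := n + 1 - k) (fun m hm => by
          rw [← (hev i (by omega) 1 one_pos).iteratedDeriv_eq]
          exact hright i (by omega) m (by omega)) q hq
      simpa using this
    have hcoeff : ∀ j ∈ Finset.range (n + 1), (∑ i ∈ Finset.Ico k (n + 1), c i j) * q.eval (r j) =
        (if j = 0 then q.eval (r j) else 0) - ∑ i ∈ Finset.range k, c i j * q.eval (r j) := by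
      intro j hj
      have h1 := htot j hj
      rw [← Finset.sum_range_add_sum_Ico (fun i => c i j) hk] at h1
      rw [← Finset.sum_mul, show ∑ i ∈ Finset.Ico k (n + 1), c i j =
        (if j = 0 then 1 else 0) - ∑ i ∈ Finset.range k, c i j by linarith, sub_mul, ite_mul,
        one_mul, zero_mul]
    rw [Finset.sum_congr rfl hcoeff, Finset.sum_sub_distrib, Finset.sum_comm,
      Finset.sum_eq_zero hlow]
    simp [hr0]

/-- The Gelfond–Bernstein basis is the pointwise limit, as `a → 0⁺`, of the
Chebyshev–Bernstein bases of the Müntz space `E(Λ_n)` on the intervals `[a,1]`. -/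
theorem chebBernstein_tendsto_gelfond (r : ℕ → ℝ) (n : ℕ) (hr0 : r 0 = 0)
    (hmono : ∀ i, i < n → r i < r (i + 1)) (B : ℝ → ℕ → ℝ → ℝ)
    (hB : ∀ a ∈ Set.Ioo (0:ℝ) 1, IsChebBernstein r n a 1 (B a)) :
    ∀ k ≤ n, ∀ t ∈ Set.Ioc (0:ℝ) 1,
      Tendsto (fun a => B a k t) (nhdsWithin 0 (Set.Ioo 0 1)) (nhds (gelfond r n k t)) := by
  intro k hk t ht
  have hr : StrictMonoOn r (Set.Iic n) := by
    refine strictMonoOn_of_lt_add_one Set.ordConnected_Iic fun i _ _ hi => hmono i ?_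
    exact hi
  choose! c hc hzero hone using fun a ha => (hB a ha).exists_coeff hr0 hr ha
  have hlim : ∀ k ≤ n + 1, _ := fun k hk =>
    tendsto_sum_mul_rpow_eval_interpolate hr hk (fun a j => ∑ i ∈ Finset.Ico k (n + 1), c a i j)
      (fun a ha => hzero a ha k hk) (fun a ha => hone a ha k hk) t
  rw [gelfond_eq_eval_interpolate_sub hr.injOn hk]
  refine ((hlim k (by omega)).sub (hlim (k + 1) (by omega))).congr' ?_
  filter_upwards [self_mem_nhdsWithin] with a ha
  rw [hc a ha k hk t ht.1, ← Finset.sum_sub_distrib]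
  refine Finset.sum_congr rfl fun j _ => ?_
  rw [Finset.sum_eq_sum_Ico_succ_bot (by omega : k < n + 1)]
  ring
end
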